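/- arXiv:hep-th/0207233 — 9 statements merged into one kernel-verified Lean document; each statement's English description precedes it below -/
import Mathlib

section
/- The conformal differential-operator realization satisfies all so(4,2) commutation relations: for all i,j ∈ {1,2,3} and μ,ν ∈ {0,1,2,3} one has [J_i,J_j] = Σ_k ε_{ijk} J_k, [J_i,K_j] = Σ_k ε_{ijk} K_k, [J_i,P_j] = Σ_k ε_{ijk} P_k, [J_i,C_j] = Σ_k ε_{ijk} C_k, [K_i,K_j] = −Σ_k ε_{ijk} J_k, [K_i,P_j] = δ_ij P_0, [K_i,P_0] = P_i, [K_i,C_0] = C_i, [K_i,C_j] = δ_ij C_0, [P_0,C_0] = D, [P_0,C_i] = −K_i, [P_i,C_0] = K_i, [P_i,C_j] = −δ_ij D + Σ_k ε_{ijk} J_k, [P_μ,D] = −P_μ, [C_μ,D] = C_μ, together with [J_i,P_0] = [J_i,C_0] = [J_i,D] = [K_i,D] = [P_μ,P_ν] = [C_μ,C_ν] = 0; and this holds for every value of the conformal weight ℓ ∈ ℝ. -/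
noncomputable section

abbrev 𝔸 : Type := Module.End ℝ (MvPolynomial (Fin 4) ℝ)

def pd (μ : Fin 4) : 𝔸 := (MvPolynomial.pderiv μ).toLinearMap
def mx (μ : Fin 4) : 𝔸 := LinearMap.mulLeft ℝ (MvPolynomial.X μ)
def eps (i j k : Fin 3) : ℝ :=
  ((j.val : ℝ) - (i.val : ℝ)) * ((k.val : ℝ) - (i.val : ℝ)) * ((k.val : ℝ) - (j.val : ℝ)) / 2

def Jgen (i : Fin 3) : 𝔸 := ∑ j : Fin 3, ∑ k : Fin 3, eps i j k • (mx k.succ * pd j.succ)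
def Pgen (μ : Fin 4) : 𝔸 := pd μ
def Kgen (i : Fin 3) : 𝔸 := -(mx i.succ * pd 0) - mx 0 * pd i.succ
def Ddil (l : ℝ) : 𝔸 := -(∑ μ : Fin 4, mx μ * pd μ) - l • (1 : 𝔸)
def Qop : 𝔸 := mx 0 * mx 0 - mx 1 * mx 1 - mx 2 * mx 2 - mx 3 * mx 3
def Egen (l : ℝ) : 𝔸 := (∑ μ : Fin 4, mx μ * pd μ) + l • (1 : 𝔸)
def C0gen (l : ℝ) : 𝔸 := (1/2 : ℝ) • (Qop * pd 0) - mx 0 * Egen l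
def Cgen (l : ℝ) (i : Fin 3) : 𝔸 := (1/2 : ℝ) • (Qop * pd i.succ) + mx i.succ * Egen l
def Cfull (l : ℝ) : Fin 4 → 𝔸 := Fin.cons (C0gen l) (fun i => Cgen l i)


open MvPolynomial

/-- The first-order differential operator `∑ μ, a μ * ∂_μ + b`. -/
def firstOrder (a : Fin 4 → MvPolynomial (Fin 4) ℝ) (b : MvPolynomial (Fin 4) ℝ) : 𝔸 :=
  (mkDerivation ℝ a).toLinearMap + LinearMap.mulLeft ℝ b

theorem firstOrder_apply (a : Fin 4 → MvPolynomial (Fin 4) ℝ) (b f : MvPolynomial (Fin 4) ℝ) :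
    firstOrder a b f = mkDerivation ℝ a f + b * f := rfl

theorem mkDerivation_eq_sum_pderiv (a : Fin 4 → MvPolynomial (Fin 4) ℝ)
    (f : MvPolynomial (Fin 4) ℝ) : mkDerivation ℝ a f = ∑ μ, a μ * pderiv μ f := by
  have h : mkDerivation ℝ a = ∑ μ, a μ • pderiv μ :=
    derivation_ext fun ν => by
      rw [mkDerivation_X, ← Derivation.coeFnAddMonoidHom_apply, map_sum, Finset.sum_apply]
      simp [pderiv_X, Pi.single_apply]
  rw [h, ← Derivation.coeFnAddMonoidHom_apply, map_sum, Finset.sum_apply]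
  simp

theorem firstOrder_apply_eq_sum (a : Fin 4 → MvPolynomial (Fin 4) ℝ)
    (b f : MvPolynomial (Fin 4) ℝ) : firstOrder a b f = ∑ μ, a μ * pderiv μ f + b * f := by
  rw [firstOrder_apply, mkDerivation_eq_sum_pderiv]

theorem lie_firstOrder (a a' : Fin 4 → MvPolynomial (Fin 4) ℝ) (b b' : MvPolynomial (Fin 4) ℝ) :
    ⁅firstOrder a b, firstOrder a' b'⁆ =
      firstOrder (fun μ => ∑ ν, (a ν * pderiv ν (a' μ) - a' ν * pderiv ν (a μ)))
        (∑ ν, (a ν * pderiv ν b' - a' ν * pderiv ν b)) := by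
  have h : mkDerivation ℝ (fun μ => ∑ ν, (a ν * pderiv ν (a' μ) - a' ν * pderiv ν (a μ))) =
      ⁅mkDerivation ℝ a, mkDerivation ℝ a'⁆ :=
    derivation_ext fun μ => by
      simp only [mkDerivation_X, Derivation.commutator_apply, Finset.sum_sub_distrib,
        mkDerivation_eq_sum_pderiv _ (a _), mkDerivation_eq_sum_pderiv _ (a' _)]
  refine LinearMap.ext fun f => ?_
  rw [firstOrder_apply, h, Finset.sum_sub_distrib, ← mkDerivation_eq_sum_pderiv,
    ← mkDerivation_eq_sum_pderiv]
  simp only [Ring.lie_def, LinearMap.sub_apply, Module.End.mul_apply, firstOrder_apply,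
    Derivation.commutator_apply, map_add, Derivation.leibniz, smul_eq_mul]
  ring

theorem firstOrder_add (a a' : Fin 4 → MvPolynomial (Fin 4) ℝ) (b b' : MvPolynomial (Fin 4) ℝ) :
    firstOrder a b + firstOrder a' b' = firstOrder (fun μ => a μ + a' μ) (b + b') := by
  refine LinearMap.ext fun f => ?_
  simp only [LinearMap.add_apply, firstOrder_apply_eq_sum, add_mul, Finset.sum_add_distrib]
  ring

theorem firstOrder_neg (a : Fin 4 → MvPolynomial (Fin 4) ℝ) (b : MvPolynomial (Fin 4) ℝ) :
    -firstOrder a b = firstOrder (fun μ => -a μ) (-b) := by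
  refine LinearMap.ext fun f => ?_
  simp only [LinearMap.neg_apply, firstOrder_apply_eq_sum, neg_mul, Finset.sum_neg_distrib]
  ring

theorem firstOrder_smul (c : ℝ) (a : Fin 4 → MvPolynomial (Fin 4) ℝ)
    (b : MvPolynomial (Fin 4) ℝ) :
    c • firstOrder a b = firstOrder (fun μ => C c * a μ) (C c * b) := by
  refine LinearMap.ext fun f => ?_
  simp only [LinearMap.smul_apply, firstOrder_apply_eq_sum, MvPolynomial.smul_eq_C_mul,
    mul_add, Finset.mul_sum, mul_assoc]

theorem firstOrder_zero : firstOrder (fun _ => 0) 0 = 0 :=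
  LinearMap.ext fun f => by simp [firstOrder_apply_eq_sum]

/-- First-order operators with pointwise equal coefficients are equal. -/
theorem firstOrder_congr {a a' : Fin 4 → MvPolynomial (Fin 4) ℝ} {b b' : MvPolynomial (Fin 4) ℝ}
    (ha : ∀ μ y, eval y (a μ) = eval y (a' μ)) (hb : ∀ y, eval y b = eval y b') :
    firstOrder a b = firstOrder a' b' := by
  rw [funext fun μ => MvPolynomial.funext (ha μ), MvPolynomial.funext hb]

/-- The quadratic form `Q / 2`. -/
def halfQ : MvPolynomial (Fin 4) ℝ :=
  C (1 / 2) * (X 0 ^ 2 - X 1 ^ 2 - X 2 ^ 2 - X 3 ^ 2)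

theorem eval_halfQ (y : Fin 4 → ℝ) :
    eval y halfQ = (y 0 ^ 2 - y 1 ^ 2 - y 2 ^ 2 - y 3 ^ 2) / 2 := by
  simp [halfQ]
  ring

theorem pderiv_halfQ (μ : Fin 4) : pderiv μ halfQ = if μ = 0 then X μ else -X μ := by
  refine MvPolynomial.funext fun y => ?_
  fin_cases μ <;> simp [halfQ, pderiv_X, Derivation.leibniz_pow]

theorem eps_eq (i j k : Fin 3) :
    eps i j k = ![![![0, 0, 0], ![0, 0, 1], ![0, -1, 0]], ![![0, 0, -1], ![0, 0, 0], ![1, 0, 0]],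
      ![![0, 1, 0], ![-1, 0, 0], ![0, 0, 0]]] i j k := by
  fin_cases i <;> fin_cases j <;> fin_cases k <;> norm_num [eps]

theorem Jgen_eq_firstOrder (i : Fin 3) : Jgen i =
    firstOrder (![![0, 0, X 3, -X 2], ![0, -X 3, 0, X 1], ![0, X 2, -X 1, 0]] i) 0 := by
  refine LinearMap.ext fun f => ?_
  rw [firstOrder_apply_eq_sum]
  fin_cases i <;> simp [Jgen, eps_eq, mx, pd, Fin.sum_univ_succ]

theorem Pgen_eq_firstOrder (μ : Fin 4) : Pgen μ = firstOrder (Pi.single μ 1) 0 := by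
  refine LinearMap.ext fun f => ?_
  simp [firstOrder_apply_eq_sum, Pgen, pd, Pi.single_apply]

theorem Kgen_eq_firstOrder (i : Fin 3) : Kgen i =
    firstOrder (![![-X 1, -X 0, 0, 0], ![-X 2, 0, -X 0, 0], ![-X 3, 0, 0, -X 0]] i) 0 := by
  refine LinearMap.ext fun f => ?_
  rw [firstOrder_apply_eq_sum]
  fin_cases i <;> simp [Kgen, mx, pd, Fin.sum_univ_succ, sub_eq_add_neg]

theorem Egen_eq_firstOrder (l : ℝ) : Egen l = firstOrder X (C l) := by
  refine LinearMap.ext fun f => ?_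
  simp [firstOrder_apply_eq_sum, Egen, mx, pd, MvPolynomial.smul_eq_C_mul]

theorem Ddil_eq_firstOrder (l : ℝ) : Ddil l = firstOrder (fun μ => -X μ) (-C l) := by
  rw [← firstOrder_neg, ← Egen_eq_firstOrder, Ddil, Egen]
  abel

theorem half_smul_Qop_mul_pd (μ : Fin 4) :
    (1 / 2 : ℝ) • (Qop * pd μ) = firstOrder (Pi.single μ halfQ) 0 := by
  refine LinearMap.ext fun f => ?_
  simp [firstOrder_apply_eq_sum, Pi.single_apply, Qop, mx, pd, halfQ, MvPolynomial.smul_eq_C_mul]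
  ring

theorem mx_mul_firstOrder (μ : Fin 4) (a : Fin 4 → MvPolynomial (Fin 4) ℝ)
    (b : MvPolynomial (Fin 4) ℝ) :
    mx μ * firstOrder a b = firstOrder (fun ν => X μ * a ν) (X μ * b) := by
  refine LinearMap.ext fun f => ?_
  simp only [mx, Module.End.mul_apply, LinearMap.mulLeft_apply, firstOrder_apply_eq_sum,
    mul_add, Finset.mul_sum, mul_assoc]

theorem C0gen_eq_firstOrder (l : ℝ) : C0gen l =
    firstOrder (fun μ => Pi.single 0 halfQ μ + -(X 0 * X μ)) (-(X 0 * C l)) := by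
  rw [C0gen, half_smul_Qop_mul_pd, Egen_eq_firstOrder, mx_mul_firstOrder, sub_eq_add_neg,
    firstOrder_neg, firstOrder_add, zero_add]

theorem Cgen_eq_firstOrder (l : ℝ) (i : Fin 3) : Cgen l i =
    firstOrder (fun μ => Pi.single i.succ halfQ μ + X i.succ * X μ) (X i.succ * C l) := by
  rw [Cgen, half_smul_Qop_mul_pd, Egen_eq_firstOrder, mx_mul_firstOrder, firstOrder_add, zero_add]

theorem lie_Jgen_Jgen (i j : Fin 3) :
    ⁅Jgen i, Jgen j⁆ = ∑ k : Fin 3, eps i j k • Jgen k := by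
  simp only [Jgen_eq_firstOrder, lie_firstOrder, Fin.sum_univ_three, firstOrder_smul,
    firstOrder_add]
  refine firstOrder_congr (fun μ y => ?_) (fun y => ?_)
  · fin_cases i <;> fin_cases j <;> fin_cases μ <;>
      simp [Fin.sum_univ_four, eps_eq, pderiv_X, Pi.single_apply]
  · fin_cases i <;> fin_cases j <;> simp [eps_eq]

theorem lie_Jgen_Kgen (i j : Fin 3) :
    ⁅Jgen i, Kgen j⁆ = ∑ k : Fin 3, eps i j k • Kgen k := by
  simp only [Jgen_eq_firstOrder, Kgen_eq_firstOrder, lie_firstOrder, Fin.sum_univ_three,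
    firstOrder_smul, firstOrder_add]
  refine firstOrder_congr (fun μ y => ?_) (fun y => ?_)
  · fin_cases i <;> fin_cases j <;> fin_cases μ <;>
      simp [Fin.sum_univ_four, eps_eq, pderiv_X, Pi.single_apply]
  · fin_cases i <;> fin_cases j <;> simp [eps_eq]

theorem lie_Jgen_Pgen_succ (i j : Fin 3) :
    ⁅Jgen i, Pgen j.succ⁆ = ∑ k : Fin 3, eps i j k • Pgen k.succ := by
  simp only [Jgen_eq_firstOrder, Pgen_eq_firstOrder, lie_firstOrder, Fin.sum_univ_three,
    firstOrder_smul, firstOrder_add]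
  refine firstOrder_congr (fun μ y => ?_) (fun y => ?_)
  · fin_cases i <;> fin_cases j <;> fin_cases μ <;> simp [eps_eq, pderiv_X, Pi.single_apply]
  · fin_cases i <;> fin_cases j <;> simp [eps_eq, Pi.single_apply]

theorem lie_Jgen_Cgen (l : ℝ) (i j : Fin 3) :
    ⁅Jgen i, Cgen l j⁆ = ∑ k : Fin 3, eps i j k • Cgen l k := by
  simp only [Jgen_eq_firstOrder, Cgen_eq_firstOrder, lie_firstOrder, Fin.sum_univ_three,
    firstOrder_smul, firstOrder_add]
  refine firstOrder_congr (fun μ y => ?_) (fun y => ?_)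
  · fin_cases i <;> fin_cases j <;> fin_cases μ <;>
      simp [Fin.sum_univ_four, eps_eq, eval_halfQ, pderiv_halfQ, pderiv_X, Pi.single_apply] <;> ring
  · fin_cases i <;> fin_cases j <;> simp [eps_eq, pderiv_X, Pi.single_apply]

theorem lie_Kgen_Kgen (i j : Fin 3) :
    ⁅Kgen i, Kgen j⁆ = -∑ k : Fin 3, eps i j k • Jgen k := by
  simp only [Jgen_eq_firstOrder, Kgen_eq_firstOrder, lie_firstOrder, Fin.sum_univ_three,
    firstOrder_smul, firstOrder_add, firstOrder_neg]
  refine firstOrder_congr (fun μ y => ?_) (fun y => ?_)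
  · fin_cases i <;> fin_cases j <;> fin_cases μ <;>
      simp [Fin.sum_univ_four, eps_eq, pderiv_X, Pi.single_apply]
  · fin_cases i <;> fin_cases j <;> simp [eps_eq]

theorem lie_Kgen_Pgen_succ (i j : Fin 3) :
    ⁅Kgen i, Pgen j.succ⁆ = (if i = j then (1:ℝ) else 0) • Pgen 0 := by
  simp only [Pgen_eq_firstOrder, Kgen_eq_firstOrder, lie_firstOrder, firstOrder_smul]
  refine firstOrder_congr (fun μ y => ?_) (fun y => ?_)
  · fin_cases i <;> fin_cases j <;> fin_cases μ <;> simp [pderiv_X, Pi.single_apply]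
  · fin_cases i <;> fin_cases j <;> simp [Pi.single_apply]

theorem lie_Kgen_Pgen_zero (i : Fin 3) :
    ⁅Kgen i, Pgen 0⁆ = Pgen i.succ := by
  simp only [Pgen_eq_firstOrder, Kgen_eq_firstOrder, lie_firstOrder]
  refine firstOrder_congr (fun μ y => ?_) (fun y => ?_)
  · fin_cases i <;> fin_cases μ <;> simp [pderiv_X, Pi.single_apply]
  · fin_cases i <;> simp [Pi.single_apply]

theorem lie_Kgen_C0gen (l : ℝ) (i : Fin 3) :
    ⁅Kgen i, C0gen l⁆ = Cgen l i := by
  simp only [Kgen_eq_firstOrder, C0gen_eq_firstOrder, Cgen_eq_firstOrder, lie_firstOrder]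
  refine firstOrder_congr (fun μ y => ?_) (fun y => ?_)
  · fin_cases i <;> fin_cases μ <;>
      simp [Fin.sum_univ_four, eval_halfQ, pderiv_halfQ, pderiv_X, Pi.single_apply] <;> ring
  · fin_cases i <;> simp [pderiv_X, Pi.single_apply]

theorem lie_Kgen_Cgen (l : ℝ) (i j : Fin 3) :
    ⁅Kgen i, Cgen l j⁆ = (if i = j then (1:ℝ) else 0) • C0gen l := by
  simp only [Kgen_eq_firstOrder, C0gen_eq_firstOrder, Cgen_eq_firstOrder, lie_firstOrder,
    firstOrder_smul]
  refine firstOrder_congr (fun μ y => ?_) (fun y => ?_)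
  · fin_cases i <;> fin_cases j <;> fin_cases μ <;>
      simp [Fin.sum_univ_four, eval_halfQ, pderiv_halfQ, pderiv_X, Pi.single_apply] <;> ring
  · fin_cases i <;> fin_cases j <;> simp [pderiv_X, Pi.single_apply]

theorem lie_Pgen_zero_C0gen (l : ℝ) :
    ⁅Pgen 0, C0gen l⁆ = Ddil l := by
  simp only [Pgen_eq_firstOrder, Ddil_eq_firstOrder, C0gen_eq_firstOrder, lie_firstOrder]
  refine firstOrder_congr (fun μ y => ?_) (fun y => ?_)
  · fin_cases μ <;> simp [pderiv_halfQ, pderiv_X, Pi.single_apply]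
  · simp [pderiv_X, Pi.single_apply]

theorem lie_Pgen_zero_Cgen (l : ℝ) (i : Fin 3) :
    ⁅Pgen 0, Cgen l i⁆ = -Kgen i := by
  simp only [Pgen_eq_firstOrder, Kgen_eq_firstOrder, Cgen_eq_firstOrder, lie_firstOrder,
    firstOrder_neg]
  refine firstOrder_congr (fun μ y => ?_) (fun y => ?_)
  · fin_cases i <;> fin_cases μ <;> simp [pderiv_halfQ, pderiv_X, Pi.single_apply]
  · fin_cases i <;> simp [pderiv_X, Pi.single_apply]

theorem lie_Pgen_succ_C0gen (l : ℝ) (i : Fin 3) :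
    ⁅Pgen i.succ, C0gen l⁆ = Kgen i := by
  simp only [Pgen_eq_firstOrder, Kgen_eq_firstOrder, C0gen_eq_firstOrder, lie_firstOrder]
  refine firstOrder_congr (fun μ y => ?_) (fun y => ?_)
  · fin_cases i <;> fin_cases μ <;> simp [pderiv_halfQ, pderiv_X, Pi.single_apply]
  · fin_cases i <;> simp [pderiv_X, Pi.single_apply]

theorem lie_Pgen_succ_Cgen (l : ℝ) (i j : Fin 3) :
    ⁅Pgen i.succ, Cgen l j⁆ =
      -((if i = j then (1:ℝ) else 0) • Ddil l) + ∑ k : Fin 3, eps i j k • Jgen k := by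
  simp only [Jgen_eq_firstOrder, Pgen_eq_firstOrder, Ddil_eq_firstOrder, Cgen_eq_firstOrder,
    lie_firstOrder, Fin.sum_univ_three, firstOrder_smul, firstOrder_add, firstOrder_neg]
  refine firstOrder_congr (fun μ y => ?_) (fun y => ?_)
  · fin_cases i <;> fin_cases j <;> fin_cases μ <;>
      simp [eps_eq, pderiv_halfQ, pderiv_X, Pi.single_apply]
  · fin_cases i <;> fin_cases j <;> simp [eps_eq, pderiv_X, Pi.single_apply]

theorem lie_Pgen_Ddil (l : ℝ) (κ : Fin 4) :
    ⁅Pgen κ, Ddil l⁆ = -Pgen κ := by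
  simp only [Pgen_eq_firstOrder, Ddil_eq_firstOrder, lie_firstOrder, firstOrder_neg]
  refine firstOrder_congr (fun μ y => ?_) (fun y => ?_)
  · fin_cases κ <;> fin_cases μ <;> simp [pderiv_X, Pi.single_apply]
  · fin_cases κ <;> simp [Pi.single_apply]

theorem lie_Jgen_Pgen_zero (i : Fin 3) :
    ⁅Jgen i, Pgen 0⁆ = 0 := by
  simp only [Jgen_eq_firstOrder, Pgen_eq_firstOrder, lie_firstOrder, ← firstOrder_zero]
  refine firstOrder_congr (fun μ y => ?_) (fun y => ?_)
  · fin_cases i <;> fin_cases μ <;> simp [pderiv_X, Pi.single_apply]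
  · fin_cases i <;> simp [Pi.single_apply]

theorem lie_Jgen_C0gen (l : ℝ) (i : Fin 3) :
    ⁅Jgen i, C0gen l⁆ = 0 := by
  simp only [Jgen_eq_firstOrder, C0gen_eq_firstOrder, lie_firstOrder, ← firstOrder_zero]
  refine firstOrder_congr (fun μ y => ?_) (fun y => ?_)
  · fin_cases i <;> fin_cases μ <;>
      simp [Fin.sum_univ_four, pderiv_halfQ, pderiv_X, Pi.single_apply] <;> ring
  · fin_cases i <;> simp [pderiv_X, Pi.single_apply]

theorem lie_Jgen_Ddil (l : ℝ) (i : Fin 3) :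
    ⁅Jgen i, Ddil l⁆ = 0 := by
  simp only [Jgen_eq_firstOrder, Ddil_eq_firstOrder, lie_firstOrder, ← firstOrder_zero]
  refine firstOrder_congr (fun μ y => ?_) (fun y => ?_)
  · fin_cases i <;> fin_cases μ <;> simp [Fin.sum_univ_four, pderiv_X, Pi.single_apply]
  · fin_cases i <;> simp

theorem lie_Kgen_Ddil (l : ℝ) (i : Fin 3) :
    ⁅Kgen i, Ddil l⁆ = 0 := by
  simp only [Kgen_eq_firstOrder, Ddil_eq_firstOrder, lie_firstOrder, ← firstOrder_zero]
  refine firstOrder_congr (fun μ y => ?_) (fun y => ?_)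
  · fin_cases i <;> fin_cases μ <;> simp [Fin.sum_univ_four, pderiv_X, Pi.single_apply]
  · fin_cases i <;> simp

theorem lie_Pgen_Pgen (κ ν : Fin 4) :
    ⁅Pgen κ, Pgen ν⁆ = 0 := by
  simp only [Pgen_eq_firstOrder, lie_firstOrder, ← firstOrder_zero]
  refine firstOrder_congr (fun μ y => ?_) (fun y => ?_)
  · fin_cases κ <;> fin_cases ν <;> fin_cases μ <;> simp [Pi.single_apply]
  · fin_cases κ <;> fin_cases ν <;> simp [Pi.single_apply]

/-- The four conformal generators in a uniform form, with the sign of `X κ` fixed by the metric. -/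
theorem Cfull_eq_firstOrder (l : ℝ) (κ : Fin 4) : Cfull l κ =
    firstOrder (fun μ => Pi.single κ halfQ μ + (if κ = 0 then -1 else 1) * (X κ * X μ))
      ((if κ = 0 then -1 else 1) * (X κ * C l)) := by
  refine Fin.cases ?_ (fun i => ?_) κ
  · simp [Cfull, C0gen_eq_firstOrder]
  · simp [Cfull, Cgen_eq_firstOrder]

theorem lie_Cfull_Ddil (l : ℝ) (κ : Fin 4) : ⁅Cfull l κ, Ddil l⁆ = Cfull l κ := by
  simp only [Cfull_eq_firstOrder, Ddil_eq_firstOrder, lie_firstOrder]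
  refine firstOrder_congr (fun μ y => ?_) (fun y => ?_)
  · fin_cases κ <;> fin_cases μ <;>
      simp [Fin.sum_univ_four, eval_halfQ, pderiv_halfQ, pderiv_X, Pi.single_apply] <;> ring
  · fin_cases κ <;> simp [pderiv_X, Pi.single_apply]

theorem lie_Cfull_Cfull (l : ℝ) (κ ν : Fin 4) : ⁅Cfull l κ, Cfull l ν⁆ = 0 := by
  simp only [Cfull_eq_firstOrder, lie_firstOrder, ← firstOrder_zero]
  refine firstOrder_congr (fun μ y => ?_) (fun y => ?_)
  · fin_cases κ <;> fin_cases ν <;> fin_cases μ <;>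
      simp [Fin.sum_univ_four, eval_halfQ, pderiv_halfQ, pderiv_X, Pi.single_apply] <;> ring
  · fin_cases κ <;> fin_cases ν <;> simp [Fin.sum_univ_four, pderiv_X, Pi.single_apply] <;> ring

/-- The conformal differential-operator realization satisfies all `so(4,2)`
commutation relations, for every conformal weight `ℓ ∈ ℝ`. -/
theorem so42_conformal_realization (l : ℝ) :
    (∀ i j : Fin 3, ⁅Jgen i, Jgen j⁆ = ∑ k : Fin 3, eps i j k • Jgen k) ∧
    (∀ i j : Fin 3, ⁅Jgen i, Kgen j⁆ = ∑ k : Fin 3, eps i j k • Kgen k) ∧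
    (∀ i j : Fin 3, ⁅Jgen i, Pgen j.succ⁆ = ∑ k : Fin 3, eps i j k • Pgen k.succ) ∧
    (∀ i j : Fin 3, ⁅Jgen i, Cgen l j⁆ = ∑ k : Fin 3, eps i j k • Cgen l k) ∧
    (∀ i j : Fin 3, ⁅Kgen i, Kgen j⁆ = -∑ k : Fin 3, eps i j k • Jgen k) ∧
    (∀ i j : Fin 3, ⁅Kgen i, Pgen j.succ⁆ = (if i = j then (1:ℝ) else 0) • Pgen 0) ∧
    (∀ i : Fin 3, ⁅Kgen i, Pgen 0⁆ = Pgen i.succ) ∧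
    (∀ i : Fin 3, ⁅Kgen i, C0gen l⁆ = Cgen l i) ∧
    (∀ i j : Fin 3, ⁅Kgen i, Cgen l j⁆ = (if i = j then (1:ℝ) else 0) • C0gen l) ∧
    ⁅Pgen 0, C0gen l⁆ = Ddil l ∧
    (∀ i : Fin 3, ⁅Pgen 0, Cgen l i⁆ = -Kgen i) ∧
    (∀ i : Fin 3, ⁅Pgen i.succ, C0gen l⁆ = Kgen i) ∧
    (∀ i j : Fin 3, ⁅Pgen i.succ, Cgen l j⁆ =
      -((if i = j then (1:ℝ) else 0) • Ddil l) + ∑ k : Fin 3, eps i j k • Jgen k) ∧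
    (∀ μ : Fin 4, ⁅Pgen μ, Ddil l⁆ = -Pgen μ) ∧
    (∀ μ : Fin 4, ⁅Cfull l μ, Ddil l⁆ = Cfull l μ) ∧
    (∀ i : Fin 3, ⁅Jgen i, Pgen 0⁆ = 0) ∧
    (∀ i : Fin 3, ⁅Jgen i, C0gen l⁆ = 0) ∧
    (∀ i : Fin 3, ⁅Jgen i, Ddil l⁆ = 0) ∧
    (∀ i : Fin 3, ⁅Kgen i, Ddil l⁆ = 0) ∧
    (∀ μ ν : Fin 4, ⁅Pgen μ, Pgen ν⁆ = 0) ∧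
    (∀ μ ν : Fin 4, ⁅Cfull l μ, Cfull l ν⁆ = 0) := by
  exact ⟨lie_Jgen_Jgen, lie_Jgen_Kgen, lie_Jgen_Pgen_succ, lie_Jgen_Cgen l, lie_Kgen_Kgen,
    lie_Kgen_Pgen_succ, lie_Kgen_Pgen_zero, lie_Kgen_C0gen l, lie_Kgen_Cgen l,
    lie_Pgen_zero_C0gen l, lie_Pgen_zero_Cgen l, lie_Pgen_succ_C0gen l, lie_Pgen_succ_Cgen l,
    lie_Pgen_Ddil l, lie_Cfull_Ddil l, lie_Jgen_Pgen_zero, lie_Jgen_C0gen l, lie_Jgen_Ddil l,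
    lie_Kgen_Ddil l, lie_Pgen_Pgen, lie_Cfull_Cfull l⟩
end
end

section
/- In any associative unital ℝ-algebra R containing elements p_0,…,p_3 and q^0,…,q^3 satisfying the canonical relations [p_μ,p_ν] = 0, [q^μ,q^ν] = 0 and [p_μ,q^ν] = δ_μν·1 for all μ,ν ∈ {0,1,2,3}, the elements J_i := Σ_{j,k} ε_{ijk} q^k p_j, P_μ := p_μ, K_i := −q^i p_0 − q^0 p_i, D := −Σ_μ q^μ p_μ − ℓ·1, C_0 := (1/2)Q p_0 − q^0(Σ_μ q^μ p_μ + ℓ·1), C_i := (1/2)Q p_i + q^i(Σ_μ q^μ p_μ + ℓ·1), with Q := (q^0)² − (q^1)² − (q^2)² − (q^3)² and any ℓ ∈ ℝ, satisfy all so(4,2) commutation relations: [J_i,J_j] = Σ_k ε_{ijk} J_k, [J_i,K_j] = Σ_k ε_{ijk} K_k, [J_i,P_j] = Σ_k ε_{ijk} P_k, [J_i,C_j] = Σ_k ε_{ijk} C_k, [K_i,K_j] = −Σ_k ε_{ijk} J_k, [K_i,P_j] = δ_ij P_0, [K_i,P_0] = P_i, [K_i,C_0] = C_i, [K_i,C_j]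 = δ_ij C_0, [P_0,C_0] = D, [P_0,C_i] = −K_i, [P_i,C_0] = K_i, [P_i,C_j] = −δ_ij D + Σ_k ε_{ijk} J_k, [P_μ,D] = −P_μ, [C_μ,D] = C_μ, and [J_i,P_0] = [J_i,C_0] = [J_i,D] = [K_i,D] = [P_μ,P_ν] = [C_μ,C_ν] = 0. -/
noncomputable section

variable {R : Type*} [Ring R] [Algebra ℝ R]

def aJ (p q : Fin 4 → R) (i : Fin 3) : R :=
  ∑ j : Fin 3, ∑ k : Fin 3, eps i j k • (q k.succ * p j.succ)
def aK (p q : Fin 4 → R) (i : Fin 3) : R := -(q i.succ * p 0) - q 0 * p i.succ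
def aD (p q : Fin 4 → R) (l : ℝ) : R := -(∑ μ : Fin 4, q μ * p μ) - l • (1 : R)
def aQ (q : Fin 4 → R) : R := q 0 * q 0 - q 1 * q 1 - q 2 * q 2 - q 3 * q 3
def aE (p q : Fin 4 → R) (l : ℝ) : R := (∑ μ : Fin 4, q μ * p μ) + l • (1 : R)
def aC (p q : Fin 4 → R) (l : ℝ) : Fin 4 → R :=
  Fin.cons ((1/2 : ℝ) • (aQ q * p 0) - q 0 * aE p q l)
    (fun i => (1/2 : ℝ) • (aQ q * p i.succ) + q i.succ * aE p q l)

set_option linter.unusedSimpArgs false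
set_option linter.unusedSectionVars false

theorem sum_eps_smul {M : Type*} [AddCommGroup M] [Module ℝ M] (i j : Fin 3) (f : Fin 3 → M) :
    ∑ k : Fin 3, eps i j k • f k =
      ![![0, f 2, -f 1], ![-f 2, 0, f 0], ![f 1, -f 0, 0]] i j := by
  fin_cases i <;> fin_cases j <;> simp [Fin.sum_univ_three, eps] <;> norm_num

theorem aJ_zero (p q : Fin 4 → R) : aJ p q 0 = q 3 * p 2 - q 2 * p 3 := by
  simp only [aJ, sum_eps_smul]
  simp [Fin.sum_univ_three, sub_eq_add_neg]

theorem aJ_one (p q : Fin 4 → R) : aJ p q 1 = q 1 * p 3 - q 3 * p 1 := by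
  simp only [aJ, sum_eps_smul]
  simp [Fin.sum_univ_three, sub_eq_add_neg, add_comm]

theorem aJ_two (p q : Fin 4 → R) : aJ p q 2 = q 2 * p 1 - q 1 * p 2 := by
  simp only [aJ, sum_eps_smul]
  simp [Fin.sum_univ_three, sub_eq_add_neg]

theorem aK_zero (p q : Fin 4 → R) : aK p q 0 = -(q 1 * p 0) - q 0 * p 1 := rfl

theorem aK_one (p q : Fin 4 → R) : aK p q 1 = -(q 2 * p 0) - q 0 * p 2 := rfl

theorem aK_two (p q : Fin 4 → R) : aK p q 2 = -(q 3 * p 0) - q 0 * p 3 := rfl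

theorem aC_zero (p q : Fin 4 → R) (l : ℝ) :
    aC p q l 0 = (1 / 2 : ℝ) • (aQ q * p 0) - q 0 * aE p q l := rfl

theorem aC_succ (p q : Fin 4 → R) (l : ℝ) (i : Fin 3) :
    aC p q l i.succ = (1 / 2 : ℝ) • (aQ q * p i.succ) + q i.succ * aE p q l := rfl

theorem aD_eq_neg_aE (p q : Fin 4 → R) (l : ℝ) : aD p q l = -aE p q l := by
  rw [aD, aE, neg_add, sub_eq_add_neg]

/-- The diagonal of the Minkowski metric of signature `(1, 3)`. -/
def minkowskiSign : Fin 4 → ℝ := ![1, -1, -1, -1]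

theorem minkowskiSign_zero : minkowskiSign 0 = 1 := rfl

theorem minkowskiSign_succ (i : Fin 3) : minkowskiSign i.succ = -1 := by
  fin_cases i <;> rfl

theorem aC_eq (p q : Fin 4 → R) (l : ℝ) (μ : Fin 4) :
    aC p q l μ = (1 / 2 : ℝ) • (aQ q * p μ) - minkowskiSign μ • (q μ * aE p q l) := by
  refine Fin.cases ?_ (fun i => ?_) μ <;> simp [aC, minkowskiSign_zero, minkowskiSign_succ]

theorem commutator_self (a : R) : ⁅a, a⁆ = 0 := sub_self _

theorem neg_commutator (a b : R) : -⁅b, a⁆ = ⁅a, b⁆ := neg_sub _ _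

theorem commutator_neg (a b : R) : ⁅a, -b⁆ = -⁅a, b⁆ := by
  simp only [Ring.lie_def]
  noncomm_ring

theorem commutator_add (a b c : R) : ⁅a, b + c⁆ = ⁅a, b⁆ + ⁅a, c⁆ := by
  simp only [Ring.lie_def]
  noncomm_ring

theorem commutator_sub (a b c : R) : ⁅a, b - c⁆ = ⁅a, b⁆ - ⁅a, c⁆ := by
  simp only [Ring.lie_def]
  noncomm_ring

theorem commutator_smul (r : ℝ) (a b : R) : ⁅a, r • b⁆ = r • ⁅a, b⁆ := by
  simp only [Ring.lie_def, mul_smul_comm, smul_mul_assoc, smul_sub]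

theorem commutator_mul (a b c : R) : ⁅a, b * c⁆ = ⁅a, b⁆ * c + b * ⁅a, c⁆ := by
  simp only [Ring.lie_def]
  noncomm_ring

/-- The canonical commutation relations. -/
structure CanonicalRelations (p q : Fin 4 → R) : Prop where
  lie_pp : ∀ μ ν : Fin 4, ⁅p μ, p ν⁆ = 0
  lie_qq : ∀ μ ν : Fin 4, ⁅q μ, q ν⁆ = 0
  lie_pq : ∀ μ ν : Fin 4, ⁅p μ, q ν⁆ = if μ = ν then (1 : R) else 0

namespace CanonicalRelations

variable {p q : Fin 4 → R}

theorem mul_p_comm (h : CanonicalRelations p q) (μ ν : Fin 4) :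
    p μ * p ν = p ν * p μ :=
  sub_eq_zero.1 (h.lie_pp μ ν)

theorem mul_q_comm (h : CanonicalRelations p q) (μ ν : Fin 4) :
    q μ * q ν = q ν * q μ :=
  sub_eq_zero.1 (h.lie_qq μ ν)

theorem p_mul_q (h : CanonicalRelations p q) (μ ν : Fin 4) :
    p μ * q ν = q ν * p μ + if μ = ν then 1 else 0 := by
  rw [← h.lie_pq, Ring.lie_def]
  abel

theorem p_mul_left_comm (h : CanonicalRelations p q) (μ ν : Fin 4) (x : R) :
    p μ * (p ν * x) = p ν * (p μ * x) := by
  rw [← mul_assoc, h.mul_p_comm, mul_assoc]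

theorem q_mul_left_comm (h : CanonicalRelations p q) (μ ν : Fin 4) (x : R) :
    q μ * (q ν * x) = q ν * (q μ * x) := by
  rw [← mul_assoc, h.mul_q_comm, mul_assoc]

theorem p_mul_q_mul (h : CanonicalRelations p q) (μ ν : Fin 4) (x : R) :
    p μ * (q ν * x) = q ν * (p μ * x) + if μ = ν then x else 0 := by
  rw [← mul_assoc, h.p_mul_q, add_mul, mul_assoc, ite_mul, one_mul, zero_mul]

theorem lie_p_aE (h : CanonicalRelations p q) (l : ℝ) (μ : Fin 4) :
    ⁅p μ, aE p q l⁆ = p μ := by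
  fin_cases μ <;>
    simp [aE, Fin.sum_univ_four, Ring.lie_def,
      mul_add, add_mul, mul_sub, sub_mul, mul_assoc, h.mul_p_comm, h.mul_q_comm, h.p_mul_q,
      h.p_mul_left_comm, h.q_mul_left_comm, h.p_mul_q_mul]

theorem lie_q_aE (h : CanonicalRelations p q) (l : ℝ) (μ : Fin 4) :
    ⁅q μ, aE p q l⁆ = -q μ := by
  fin_cases μ <;>
    simp [aE, Fin.sum_univ_four, Ring.lie_def,
      mul_add, add_mul, mul_sub, sub_mul, mul_assoc, h.mul_p_comm, h.mul_q_comm, h.p_mul_q,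
      h.p_mul_left_comm, h.q_mul_left_comm, h.p_mul_q_mul]

theorem lie_p_aQ (h : CanonicalRelations p q) (μ : Fin 4) :
    ⁅p μ, aQ q⁆ = (2 * minkowskiSign μ) • q μ := by
  fin_cases μ <;>
    simp [aQ, minkowskiSign, Ring.lie_def, mul_add, add_mul, mul_sub,
      sub_mul, mul_assoc, h.mul_p_comm, h.mul_q_comm, h.p_mul_q, h.p_mul_left_comm,
      h.q_mul_left_comm, h.p_mul_q_mul] <;>
    module

theorem lie_q_aQ (h : CanonicalRelations p q) (μ : Fin 4) :
    ⁅q μ, aQ q⁆ = 0 := by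
  simp [aQ, Ring.lie_def, mul_add, add_mul, mul_sub,
    sub_mul, mul_assoc, h.mul_p_comm, h.mul_q_comm, h.p_mul_q, h.p_mul_left_comm,
    h.q_mul_left_comm, h.p_mul_q_mul]

theorem lie_aQ_aE (h : CanonicalRelations p q) (l : ℝ) :
    ⁅aQ q, aE p q l⁆ = (-2 : ℝ) • aQ q := by
  rw [← neg_commutator]
  simp only [aQ, commutator_sub, commutator_mul, ← neg_commutator (aE p q l) (q _),
    h.lie_q_aE]
  simp only [neg_neg, mul_neg, neg_mul]
  module

theorem lie_aJ_q_zero (h : CanonicalRelations p q) (i : Fin 3) :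
    ⁅aJ p q i, q 0⁆ = 0 := by
  fin_cases i <;>
    simp [aJ_zero, aJ_one, aJ_two, Ring.lie_def, mul_add, add_mul, mul_sub,
      sub_mul, mul_assoc, h.mul_p_comm, h.mul_q_comm, h.p_mul_q, h.p_mul_left_comm,
      h.q_mul_left_comm, h.p_mul_q_mul]

theorem lie_aJ_q_succ (h : CanonicalRelations p q) (i j : Fin 3) :
    ⁅aJ p q i, q j.succ⁆ = ∑ k : Fin 3, eps i j k • q k.succ := by
  fin_cases i <;> fin_cases j <;>
    simp [sum_eps_smul, aJ_zero, aJ_one, aJ_two, Ring.lie_def, mul_add, add_mul, mul_sub,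
      sub_mul, mul_assoc, h.mul_p_comm, h.mul_q_comm, h.p_mul_q, h.p_mul_left_comm,
      h.q_mul_left_comm, h.p_mul_q_mul]

theorem lie_aJ_p_zero (h : CanonicalRelations p q) (i : Fin 3) :
    ⁅aJ p q i, p 0⁆ = 0 := by
  fin_cases i <;>
    simp [aJ_zero, aJ_one, aJ_two, Ring.lie_def, mul_add, add_mul, mul_sub,
      sub_mul, mul_assoc, h.mul_p_comm, h.mul_q_comm, h.p_mul_q, h.p_mul_left_comm,
      h.q_mul_left_comm, h.p_mul_q_mul]

theorem lie_aJ_p_succ (h : CanonicalRelations p q) (i j : Fin 3) :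
    ⁅aJ p q i, p j.succ⁆ = ∑ k : Fin 3, eps i j k • p k.succ := by
  fin_cases i <;> fin_cases j <;>
    simp [sum_eps_smul, aJ_zero, aJ_one, aJ_two, Ring.lie_def, mul_add, add_mul, mul_sub,
      sub_mul, mul_assoc, h.mul_p_comm, h.mul_q_comm, h.p_mul_q, h.p_mul_left_comm,
      h.q_mul_left_comm, h.p_mul_q_mul]

theorem lie_aJ_aJ (h : CanonicalRelations p q) (i j : Fin 3) :
    ⁅aJ p q i, aJ p q j⁆ = ∑ k : Fin 3, eps i j k • aJ p q k := by
  fin_cases i <;> fin_cases j <;>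
    simp [sum_eps_smul, aJ_zero, aJ_one, aJ_two, Ring.lie_def, mul_add, add_mul, mul_sub,
      sub_mul, mul_assoc, h.mul_p_comm, h.mul_q_comm, h.p_mul_q, h.p_mul_left_comm,
      h.q_mul_left_comm, h.p_mul_q_mul] <;>
    module

theorem lie_aJ_aK (h : CanonicalRelations p q) (i j : Fin 3) :
    ⁅aJ p q i, aK p q j⁆ = ∑ k : Fin 3, eps i j k • aK p q k := by
  fin_cases i <;> fin_cases j <;>
    simp [sum_eps_smul, aJ_zero, aJ_one, aJ_two, aK_zero, aK_one, aK_two, Ring.lie_def,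
      mul_add, add_mul, mul_sub, sub_mul, mul_assoc, h.mul_p_comm, h.mul_q_comm, h.p_mul_q,
      h.p_mul_left_comm, h.q_mul_left_comm, h.p_mul_q_mul] <;>
    module

theorem lie_aJ_aQ (h : CanonicalRelations p q) (i : Fin 3) :
    ⁅aJ p q i, aQ q⁆ = 0 := by
  fin_cases i <;>
    simp [aJ_zero, aJ_one, aJ_two, aQ, Ring.lie_def, mul_add, add_mul, mul_sub,
      sub_mul, mul_assoc, h.mul_p_comm, h.mul_q_comm, h.p_mul_q, h.p_mul_left_comm,
      h.q_mul_left_comm, h.p_mul_q_mul] <;>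
    module

theorem lie_aJ_aE (h : CanonicalRelations p q) (l : ℝ) (i : Fin 3) :
    ⁅aJ p q i, aE p q l⁆ = 0 := by
  fin_cases i <;>
    simp [aJ_zero, aJ_one, aJ_two, aE, Fin.sum_univ_four, Ring.lie_def,
      mul_add, add_mul, mul_sub, sub_mul, mul_assoc, h.mul_p_comm, h.mul_q_comm, h.p_mul_q,
      h.p_mul_left_comm, h.q_mul_left_comm, h.p_mul_q_mul] <;>
    module

theorem lie_aK_q_zero (h : CanonicalRelations p q) (i : Fin 3) :
    ⁅aK p q i, q 0⁆ = -q i.succ := by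
  fin_cases i <;>
    simp [aK_zero, aK_one, aK_two, Ring.lie_def,
      mul_add, add_mul, mul_sub, sub_mul, mul_assoc, h.mul_p_comm, h.mul_q_comm, h.p_mul_q,
      h.p_mul_left_comm, h.q_mul_left_comm, h.p_mul_q_mul]

theorem lie_aK_q_succ (h : CanonicalRelations p q) (i j : Fin 3) :
    ⁅aK p q i, q j.succ⁆ = -((if i = j then (1:ℝ) else 0) • q 0) := by
  fin_cases i <;> fin_cases j <;>
    simp [aK_zero, aK_one, aK_two, Ring.lie_def,
      mul_add, add_mul, mul_sub, sub_mul, mul_assoc, h.mul_p_comm, h.mul_q_comm, h.p_mul_q,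
      h.p_mul_left_comm, h.q_mul_left_comm, h.p_mul_q_mul]

theorem lie_aK_p_zero (h : CanonicalRelations p q) (i : Fin 3) :
    ⁅aK p q i, p 0⁆ = p i.succ := by
  fin_cases i <;>
    simp [aK_zero, aK_one, aK_two, Ring.lie_def,
      mul_add, add_mul, mul_sub, sub_mul, mul_assoc, h.mul_p_comm, h.mul_q_comm, h.p_mul_q,
      h.p_mul_left_comm, h.q_mul_left_comm, h.p_mul_q_mul]

theorem lie_aK_p_succ (h : CanonicalRelations p q) (i j : Fin 3) :
    ⁅aK p q i, p j.succ⁆ = (if i = j then (1:ℝ) else 0) • p 0 := by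
  fin_cases i <;> fin_cases j <;>
    simp [aK_zero, aK_one, aK_two, Ring.lie_def,
      mul_add, add_mul, mul_sub, sub_mul, mul_assoc, h.mul_p_comm, h.mul_q_comm, h.p_mul_q,
      h.p_mul_left_comm, h.q_mul_left_comm, h.p_mul_q_mul]

theorem lie_aK_aK (h : CanonicalRelations p q) (i j : Fin 3) :
    ⁅aK p q i, aK p q j⁆ = -∑ k : Fin 3, eps i j k • aJ p q k := by
  fin_cases i <;> fin_cases j <;>
    simp [sum_eps_smul, aJ_zero, aJ_one, aJ_two, aK_zero, aK_one, aK_two, Ring.lie_def,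
      mul_add, add_mul, mul_sub, sub_mul, mul_assoc, h.mul_p_comm, h.mul_q_comm, h.p_mul_q,
      h.p_mul_left_comm, h.q_mul_left_comm, h.p_mul_q_mul] <;>
    module

theorem lie_aK_aQ (h : CanonicalRelations p q) (i : Fin 3) :
    ⁅aK p q i, aQ q⁆ = 0 := by
  fin_cases i <;>
    simp [aK_zero, aK_one, aK_two, aQ, Ring.lie_def, mul_add, add_mul, mul_sub,
      sub_mul, mul_assoc, h.mul_p_comm, h.mul_q_comm, h.p_mul_q, h.p_mul_left_comm,
      h.q_mul_left_comm, h.p_mul_q_mul] <;>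
    module

theorem lie_aK_aE (h : CanonicalRelations p q) (l : ℝ) (i : Fin 3) :
    ⁅aK p q i, aE p q l⁆ = 0 := by
  fin_cases i <;>
    simp [aK_zero, aK_one, aK_two, aE, Fin.sum_univ_four, Ring.lie_def,
      mul_add, add_mul, mul_sub, sub_mul, mul_assoc, h.mul_p_comm, h.mul_q_comm, h.p_mul_q,
      h.p_mul_left_comm, h.q_mul_left_comm, h.p_mul_q_mul] <;>
    module

theorem lie_aJ_aC_zero (h : CanonicalRelations p q) (l : ℝ) (i : Fin 3) :
    ⁅aJ p q i, aC p q l 0⁆ = 0 := by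
  simp [aC_zero, commutator_sub, commutator_smul, commutator_mul, h.lie_aJ_aQ, h.lie_aJ_aE,
    h.lie_aJ_p_zero, h.lie_aJ_q_zero]

theorem lie_aJ_aC_succ (h : CanonicalRelations p q) (l : ℝ) (i j : Fin 3) :
    ⁅aJ p q i, aC p q l j.succ⁆ = ∑ k : Fin 3, eps i j k • aC p q l k.succ := by
  simp [aC_succ, commutator_add, commutator_smul, commutator_mul, h.lie_aJ_aQ, h.lie_aJ_aE,
    h.lie_aJ_p_succ, h.lie_aJ_q_succ, Finset.mul_sum, Finset.sum_mul, Finset.smul_sum,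
    Finset.sum_add_distrib, smul_comm (2⁻¹ : ℝ)]

theorem lie_aK_aC_zero (h : CanonicalRelations p q) (l : ℝ) (i : Fin 3) :
    ⁅aK p q i, aC p q l 0⁆ = aC p q l i.succ := by
  simp [aC_zero, aC_succ, commutator_sub, commutator_smul, commutator_mul, h.lie_aK_aQ,
    h.lie_aK_aE, h.lie_aK_p_zero, h.lie_aK_q_zero]

theorem lie_aK_aC_succ (h : CanonicalRelations p q) (l : ℝ) (i j : Fin 3) :
    ⁅aK p q i, aC p q l j.succ⁆ = (if i = j then (1:ℝ) else 0) • aC p q l 0 := by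
  simp only [aC_zero, aC_succ, commutator_mul, h.lie_aK_aQ, h.lie_aK_aE, h.lie_aK_p_succ,
    h.lie_aK_q_succ, commutator_add, commutator_smul]
  split_ifs <;> simp [sub_eq_add_neg]

theorem lie_p_aC (h : CanonicalRelations p q) (l : ℝ) (μ ν : Fin 4) :
    ⁅p μ, aC p q l ν⁆ = minkowskiSign μ • (q μ * p ν) - minkowskiSign ν • (q ν * p μ) -
      (if μ = ν then minkowskiSign ν else 0) • aE p q l := by
  simp only [aC_eq, commutator_mul, h.lie_p_aQ, h.lie_p_aE, h.lie_pp, h.lie_pq,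
    commutator_sub, commutator_smul]
  obtain rfl | hne := eq_or_ne μ ν
  · simp
    module
  · simp [hne]
    module

theorem lie_aC_aE (h : CanonicalRelations p q) (l : ℝ) (μ : Fin 4) :
    ⁅aC p q l μ, aE p q l⁆ = -aC p q l μ := by
  rw [← neg_commutator]
  simp only [aC_eq, commutator_mul, commutator_sub, commutator_smul, commutator_self,
    ← neg_commutator (aE p q l) (p _), ← neg_commutator (aE p q l) (q _),
    ← neg_commutator (aE p q l) (aQ q), h.lie_p_aE, h.lie_q_aE, h.lie_aQ_aE]
  simp
  module

theorem lie_aC_aC (h : CanonicalRelations p q) (l : ℝ) (μ ν : Fin 4) :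
    ⁅aC p q l μ, aC p q l ν⁆ = 0 := by
  have hpE (μ) : p μ * aE p q l = aE p q l * p μ + p μ := by
    rw [← sub_eq_iff_eq_add', ← Ring.lie_def, h.lie_p_aE]
  have hEq (μ) (x) : aE p q l * (q μ * x) = q μ * (aE p q l * x) + q μ * x := by
    rw [← sub_eq_iff_eq_add', ← mul_assoc, ← mul_assoc, ← sub_mul, ← Ring.lie_def,
      ← neg_commutator, h.lie_q_aE, neg_neg]
  have hEQ (x) : aE p q l * (aQ q * x) = aQ q * (aE p q l * x) + (2 : ℝ) • (aQ q * x) := by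
    rw [← sub_eq_iff_eq_add', ← mul_assoc, ← mul_assoc, ← sub_mul, ← Ring.lie_def,
      ← neg_commutator, h.lie_aQ_aE, neg_smul, neg_neg, smul_mul_assoc]
  have hpQ (μ) (x) : p μ * (aQ q * x) = aQ q * (p μ * x) + (2 * minkowskiSign μ) • (q μ * x) := by
    rw [← sub_eq_iff_eq_add', ← mul_assoc, ← mul_assoc, ← sub_mul, ← Ring.lie_def, h.lie_p_aQ,
      smul_mul_assoc]
  have hqQ (μ) (x) : q μ * (aQ q * x) = aQ q * (q μ * x) := by
    rw [← sub_eq_zero, ← mul_assoc, ← mul_assoc, ← sub_mul, ← Ring.lie_def, h.lie_q_aQ, zero_mul]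
  rcases eq_or_ne μ ν with rfl | hne
  · exact commutator_self _
  simp only [aC_eq, Ring.lie_def, mul_sub, sub_mul, mul_assoc, smul_mul_assoc, mul_smul_comm, hpE,
    hEq, hEQ, hpQ, hqQ, mul_add, h.mul_p_comm ν μ, h.mul_q_comm ν μ, h.q_mul_left_comm ν μ,
    h.p_mul_q_mul, if_neg hne, if_neg hne.symm, add_zero]
  module

end CanonicalRelations

/-- Abstract substitution principle: any realization of the canonical commutation
relations in an associative unital ℝ-algebra yields a realization of `so(4,2)`. -/
theorem so42_abstract_substitution (p q : Fin 4 → R) (l : ℝ)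
    (hpp : ∀ μ ν : Fin 4, ⁅p μ, p ν⁆ = 0)
    (hqq : ∀ μ ν : Fin 4, ⁅q μ, q ν⁆ = 0)
    (hpq : ∀ μ ν : Fin 4, ⁅p μ, q ν⁆ = if μ = ν then (1 : R) else 0) :
    (∀ i j : Fin 3, ⁅aJ p q i, aJ p q j⁆ = ∑ k : Fin 3, eps i j k • aJ p q k) ∧
    (∀ i j : Fin 3, ⁅aJ p q i, aK p q j⁆ = ∑ k : Fin 3, eps i j k • aK p q k) ∧
    (∀ i j : Fin 3, ⁅aJ p q i, p j.succ⁆ = ∑ k : Fin 3, eps i j k • p k.succ) ∧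
    (∀ i j : Fin 3, ⁅aJ p q i, aC p q l j.succ⁆ = ∑ k : Fin 3, eps i j k • aC p q l k.succ) ∧
    (∀ i j : Fin 3, ⁅aK p q i, aK p q j⁆ = -∑ k : Fin 3, eps i j k • aJ p q k) ∧
    (∀ i j : Fin 3, ⁅aK p q i, p j.succ⁆ = (if i = j then (1:ℝ) else 0) • p 0) ∧
    (∀ i : Fin 3, ⁅aK p q i, p 0⁆ = p i.succ) ∧
    (∀ i : Fin 3, ⁅aK p q i, aC p q l 0⁆ = aC p q l i.succ) ∧
    (∀ i j : Fin 3, ⁅aK p q i, aC p q l j.succ⁆ = (if i = j then (1:ℝ) else 0) • aC p q l 0) ∧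
    ⁅p 0, aC p q l 0⁆ = aD p q l ∧
    (∀ i : Fin 3, ⁅p 0, aC p q l i.succ⁆ = -aK p q i) ∧
    (∀ i : Fin 3, ⁅p i.succ, aC p q l 0⁆ = aK p q i) ∧
    (∀ i j : Fin 3, ⁅p i.succ, aC p q l j.succ⁆ =
      -((if i = j then (1:ℝ) else 0) • aD p q l) + ∑ k : Fin 3, eps i j k • aJ p q k) ∧
    (∀ μ : Fin 4, ⁅p μ, aD p q l⁆ = -p μ) ∧
    (∀ μ : Fin 4, ⁅aC p q l μ, aD p q l⁆ = aC p q l μ) ∧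
    (∀ i : Fin 3, ⁅aJ p q i, p 0⁆ = 0) ∧
    (∀ i : Fin 3, ⁅aJ p q i, aC p q l 0⁆ = 0) ∧
    (∀ i : Fin 3, ⁅aJ p q i, aD p q l⁆ = 0) ∧
    (∀ i : Fin 3, ⁅aK p q i, aD p q l⁆ = 0) ∧
    (∀ μ ν : Fin 4, ⁅p μ, p ν⁆ = 0) ∧
    (∀ μ ν : Fin 4, ⁅aC p q l μ, aC p q l ν⁆ = 0) := by
  have h : CanonicalRelations p q := ⟨hpp, hqq, hpq⟩
  refine ⟨h.lie_aJ_aJ, h.lie_aJ_aK, h.lie_aJ_p_succ, h.lie_aJ_aC_succ l, h.lie_aK_aK,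
    h.lie_aK_p_succ, h.lie_aK_p_zero, h.lie_aK_aC_zero l, h.lie_aK_aC_succ l, ?_, fun i => ?_,
    fun i => ?_, fun i j => ?_, fun μ => ?_, fun μ => ?_, h.lie_aJ_p_zero, h.lie_aJ_aC_zero l,
    fun i => ?_, fun i => ?_, hpp, h.lie_aC_aC l⟩
  · simp [h.lie_p_aC, minkowskiSign_zero, minkowskiSign_succ, aD_eq_neg_aE]
  · simp [h.lie_p_aC, minkowskiSign_zero, minkowskiSign_succ, aK, (Fin.succ_ne_zero i).symm]
  · simp [h.lie_p_aC, minkowskiSign_zero, minkowskiSign_succ, aK]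
  · rw [h.lie_p_aC, aD_eq_neg_aE, sum_eps_smul]
    fin_cases i <;> fin_cases j <;>
      simp [minkowskiSign, aJ_zero, aJ_one, aJ_two] <;> abel
  · rw [aD_eq_neg_aE, commutator_neg, h.lie_p_aE]
  · rw [aD_eq_neg_aE, commutator_neg, h.lie_aC_aE, neg_neg]
  · rw [aD_eq_neg_aE, commutator_neg, h.lie_aJ_aE, neg_zero]
  · rw [aD_eq_neg_aE, commutator_neg, h.lie_aK_aE, neg_zero]
end
end

section
/- The d'Alembertian □ := ∂_0² − ∂_1² − ∂_2² − ∂_3² (equivalently □ = P_0² − P_1² − P_2² − P_3²) satisfies [P_μ, □] = 0 for all μ ∈ {0,1,2,3}, [J_i, □] = 0 and [K_i, □] = 0 for all i ∈ {1,2,3}, and [D, □] = 2□, for every conformal weight ℓ ∈ ℝ. -/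
noncomputable section

/-- The d'Alembertian `□ = ∂_0² − ∂_1² − ∂_2² − ∂_3² = P_0² − P_1² − P_2² − P_3²`. -/
def box : 𝔸 := pd 0 * pd 0 - pd 1 * pd 1 - pd 2 * pd 2 - pd 3 * pd 3

section Weyl

variable {A : Type*} [Ring A]

/-- The Minkowski quadratic form `d_0² − d_1² − d_2² − d_3²` in elements of a ring. -/
def minkowskiSq (d : Fin 4 → A) : A := d 0 * d 0 - d 1 * d 1 - d 2 * d 2 - d 3 * d 3

lemma lie_minkowskiSq_eq_zero {d : Fin 4 → A} (hd : ∀ a b, d a * d b = d b * d a) (a : Fin 4) :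
    ⁅d a, minkowskiSq d⁆ = 0 := by
  have h (c : Fin 4) : Commute (d a) (d c * d c) := Commute.mul_right (hd a c) (hd a c)
  exact ((((h 0).sub_right (h 1)).sub_right (h 2)).sub_right (h 3)).lie_eq

attribute [local instance] LieRing.ofAssociativeRing

variable [Algebra ℝ A] {x d : Fin 4 → A}

/-- In the Weyl algebra relations, the bracket of `x_a d_b` with `d_c²`. -/
lemma mul_lie_mul_self (hd : ∀ a b, d a * d b = d b * d a)
    (hx : ∀ a b, d a * x b = x b * d a + if a = b then 1 else 0) (a b c : Fin 4) :
    ⁅x a * d b, d c * d c⁆ = if c = a then (-2 : ℝ) • (d a * d b) else 0 := by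
  have hb : Commute (d b) (d c * d c) := Commute.mul_right (hd b c) (hd b c)
  have hxc : d c * d c * x a = x a * (d c * d c) + if c = a then (2 : ℝ) • d a else 0 := by
    rw [mul_assoc, hx, mul_add, ← mul_assoc, hx, add_mul, mul_assoc]
    split_ifs with h
    · subst h
      simp [two_smul, add_assoc]
    · simp
  rw [LieRing.of_associative_ring_bracket, mul_assoc, hb.eq, ← mul_assoc, ← mul_assoc (d c * d c),
    hxc, add_mul]
  split_ifs <;> simp

lemma mul_lie_minkowskiSq (hd : ∀ a b, d a * d b = d b * d a)
    (hx : ∀ a b, d a * x b = x b * d a + if a = b then 1 else 0) (a b : Fin 4) :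
    ⁅x a * d b, minkowskiSq d⁆ = (if a = 0 then (-2 : ℝ) else 2) • (d a * d b) := by
  simp only [minkowskiSq, lie_sub, mul_lie_mul_self hd hx]
  fin_cases a <;> simp

lemma rotation_lie_minkowskiSq (hd : ∀ a b, d a * d b = d b * d a)
    (hx : ∀ a b, d a * x b = x b * d a + if a = b then 1 else 0)
    {e : Fin 3 → Fin 3 → ℝ} (he : ∀ j k, e k j = -e j k) :
    ⁅∑ j : Fin 3, ∑ k : Fin 3, e j k • (x k.succ * d j.succ), minkowskiSq d⁆ = 0 := by
  have h : ⁅∑ j : Fin 3, ∑ k : Fin 3, e j k • (x k.succ * d j.succ), minkowskiSq d⁆ =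
      ∑ j : Fin 3, ∑ k : Fin 3, (e j k * 2) • (d k.succ * d j.succ) := by
    simp only [sum_lie, smul_lie, mul_lie_minkowskiSq hd hx, Fin.succ_ne_zero, if_false, smul_smul]
  have hdiag (j : Fin 3) : e j j = 0 := self_eq_neg.mp (he j j)
  rw [h]
  simp only [Fin.sum_univ_three, hdiag, he 0 1, he 0 2, he 1 2, hd (Fin.succ 1) (Fin.succ 0),
    hd (Fin.succ 2) (Fin.succ 0), hd (Fin.succ 2) (Fin.succ 1)]
  module

lemma boost_lie_minkowskiSq (hd : ∀ a b, d a * d b = d b * d a)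
    (hx : ∀ a b, d a * x b = x b * d a + if a = b then 1 else 0) (i : Fin 3) :
    ⁅-(x i.succ * d 0) - x 0 * d i.succ, minkowskiSq d⁆ = 0 := by
  rw [sub_lie, neg_lie, mul_lie_minkowskiSq hd hx, mul_lie_minkowskiSq hd hx, hd 0]
  simp

lemma dilation_lie_minkowskiSq (hd : ∀ a b, d a * d b = d b * d a)
    (hx : ∀ a b, d a * x b = x b * d a + if a = b then 1 else 0) (l : ℝ) :
    ⁅-(∑ a : Fin 4, x a * d a) - l • (1 : A), minkowskiSq d⁆ = (2 : ℝ) • minkowskiSq d := by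
  have h1 : ⁅l • (1 : A), minkowskiSq d⁆ = 0 := by
    simp [LieRing.of_associative_ring_bracket]
  rw [sub_lie, neg_lie, h1, Fin.sum_univ_four]
  simp only [add_lie, mul_lie_minkowskiSq hd hx, if_true, one_ne_zero, if_false,
    show (2 : Fin 4) ≠ 0 by decide, show (3 : Fin 4) ≠ 0 by decide]
  rw [minkowskiSq]
  module

end Weyl

lemma pd_mul_pd_comm (a b : Fin 4) : pd a * pd b = pd b * pd a := by
  have h : ⁅MvPolynomial.pderiv (R := ℝ) a, MvPolynomial.pderiv b⁆ = 0 :=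
    MvPolynomial.derivation_ext fun i => by
      rw [Derivation.commutator_apply, MvPolynomial.pderiv_X, MvPolynomial.pderiv_X,
        Pi.single_apply, Pi.single_apply]
      split_ifs <;> simp
  have hp (p : MvPolynomial (Fin 4) ℝ) :
      MvPolynomial.pderiv a (MvPolynomial.pderiv b p) =
        MvPolynomial.pderiv b (MvPolynomial.pderiv a p) := by
    rw [← sub_eq_zero, ← Derivation.commutator_apply, h, Derivation.zero_apply]
  exact LinearMap.ext hp

lemma pd_mul_mx (a b : Fin 4) : pd a * mx b = mx b * pd a + if a = b then 1 else 0 := by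
  refine LinearMap.ext fun p => ?_
  have h : MvPolynomial.pderiv a (MvPolynomial.X b * p) = MvPolynomial.X b *
      MvPolynomial.pderiv a p + if a = b then p else (0 : MvPolynomial (Fin 4) ℝ) := by
    rw [Derivation.leibniz, MvPolynomial.pderiv_X, Pi.single_apply, smul_eq_mul, smul_eq_mul]
    simp [eq_comm]
  refine h.trans ?_
  split_ifs <;> rfl

/-- The d'Alembertian commutes with translations, rotations and boosts, and has
dilation weight `2`, for every conformal weight `ℓ ∈ ℝ`. -/
theorem dalembertian_commutators (l : ℝ) :
    box = Pgen 0 * Pgen 0 - Pgen 1 * Pgen 1 - Pgen 2 * Pgen 2 - Pgen 3 * Pgen 3 ∧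
    (∀ μ : Fin 4, ⁅Pgen μ, box⁆ = 0) ∧
    (∀ i : Fin 3, ⁅Jgen i, box⁆ = 0) ∧
    (∀ i : Fin 3, ⁅Kgen i, box⁆ = 0) ∧
    ⁅Ddil l, box⁆ = (2 : ℝ) • box := by
  exact ⟨rfl, lie_minkowskiSq_eq_zero pd_mul_pd_comm,
    fun i => rotation_lie_minkowskiSq pd_mul_pd_comm pd_mul_mx
      fun j k => by simp only [eps]; ring,
    boost_lie_minkowskiSq pd_mul_pd_comm pd_mul_mx,
    dilation_lie_minkowskiSq pd_mul_pd_comm pd_mul_mx l⟩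
end
end

section
/- The special conformal generators satisfy, for every conformal weight ℓ ∈ ℝ, the commutation relations [C_0, □] = 2 x^0 □ + 2(ℓ − 1) ∂_0 and [C_i, □] = −2 x^i □ + 2(ℓ − 1) ∂_i for i ∈ {1,2,3}, where □ := ∂_0² − ∂_1² − ∂_2² − ∂_3². -/
noncomputable section

open MvPolynomial in
theorem pd_comm (i j : Fin 4) (f : MvPolynomial (Fin 4) ℝ) :
    pd i (pd j f) = pd j (pd i f) := by
  let D (k : Fin 4) : Derivation ℝ (MvPolynomial (Fin 4) ℝ) (MvPolynomial (Fin 4) ℝ) := pderiv k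
  have h : ⁅D i, D j⁆ = 0 := derivation_ext fun k => by
    rw [Derivation.commutator_apply]
    simp [D, pderiv_X, Pi.single_apply, apply_ite]
  have hf := congrArg (fun E => E f) h
  rwa [Derivation.commutator_apply, Derivation.zero_apply, sub_eq_zero] at hf

theorem pd_mul (i : Fin 4) (f g : MvPolynomial (Fin 4) ℝ) :
    pd i (f * g) = pd i f * g + f * pd i g := by
  simp [pd, Derivation.leibniz, add_comm, mul_comm]

theorem pd_X (i j : Fin 4) :
    pd i (MvPolynomial.X j : MvPolynomial (Fin 4) ℝ) = if i = j then 1 else 0 := by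
  simp [pd, MvPolynomial.pderiv_X, Pi.single_apply, eq_comm]

theorem pd_mx (i j : Fin 4) (f : MvPolynomial (Fin 4) ℝ) :
    pd i (mx j f) = mx j (pd i f) + if i = j then f else 0 := by
  simp [mx, pd_mul, pd_X, add_comm]

/-- The Euler operator `∑ μ, x^μ ∂_μ`. -/
def euler : 𝔸 := ∑ μ : Fin 4, mx μ * pd μ

theorem Egen_eq (l : ℝ) : Egen l = euler + l • (1 : 𝔸) := rfl

theorem pd_euler (i : Fin 4) (f : MvPolynomial (Fin 4) ℝ) :
    pd i (euler f) = euler (pd i f) + pd i f := by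
  simp [euler, LinearMap.sum_apply, pd_mx, pd_comm i, Finset.sum_add_distrib]

theorem box_apply (f : MvPolynomial (Fin 4) ℝ) :
    box f = pd 0 (pd 0 f) - pd 1 (pd 1 f) - pd 2 (pd 2 f) - pd 3 (pd 3 f) := rfl

theorem box_pd (i : Fin 4) (f : MvPolynomial (Fin 4) ℝ) : box (pd i f) = pd i (box f) := by
  simp only [box_apply, map_sub, pd_comm i]

theorem box_euler (f : MvPolynomial (Fin 4) ℝ) :
    box (euler f) = euler (box f) + (2 : ℝ) • box f := by
  simp only [box_apply, pd_euler, map_sub, map_add]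
  module

theorem box_mx_zero (f : MvPolynomial (Fin 4) ℝ) :
    box (mx 0 f) = mx 0 (box f) + (2 : ℝ) • pd 0 f := by
  simp only [box_apply, pd_mx, map_sub, map_add, Fin.reduceEq, if_true, if_false, add_zero]
  module

theorem box_mx_succ (i : Fin 3) (f : MvPolynomial (Fin 4) ℝ) :
    box (mx i.succ f) = mx i.succ (box f) - (2 : ℝ) • pd i.succ f := by
  fin_cases i <;>
  · simp only [Fin.zero_eta, Fin.mk_one, Fin.reduceFinMk, Fin.reduceSucc, Fin.succ_zero_eq_one,
      Fin.succ_one_eq_two, box_apply, pd_mx, map_sub, map_add, Fin.reduceEq, if_true, if_false,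
      add_zero]
    module

theorem box_Qop (f : MvPolynomial (Fin 4) ℝ) :
    box (Qop f) = Qop (box f) + (4 : ℝ) • euler f + (8 : ℝ) • f := by
  have h1 := box_mx_succ 0
  have h2 := box_mx_succ 1
  have h3 := box_mx_succ 2
  simp only [Fin.succ_zero_eq_one, Fin.succ_one_eq_two, Fin.reduceSucc] at h1 h2 h3
  simp only [Qop, euler, Fin.sum_univ_four, Module.End.mul_apply, LinearMap.sub_apply,
    LinearMap.add_apply, map_sub, map_add, map_smul, box_mx_zero, h1, h2, h3, pd_mx, if_true]
  module

/-- Commutators of the special conformal generators with the d'Alembertian: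
`[C_0, □] = 2x^0 □ + 2(ℓ−1)∂_0` and `[C_i, □] = −2x^i □ + 2(ℓ−1)∂_i`. -/
theorem special_conformal_dalembertian (l : ℝ) :
    ⁅C0gen l, box⁆ = (2 : ℝ) • (mx 0 * box) + (2 * (l - 1)) • pd 0 ∧
    (∀ i : Fin 3, ⁅Cgen l i, box⁆ = -((2 : ℝ) • (mx i.succ * box)) + (2 * (l - 1)) • pd i.succ) := by
  refine ⟨LinearMap.ext fun f => ?_, fun i => LinearMap.ext fun f => ?_⟩
  · simp only [Ring.lie_def, C0gen, Egen_eq, Module.End.mul_apply, LinearMap.sub_apply,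
      LinearMap.add_apply, LinearMap.smul_apply, Module.End.one_apply, map_sub, map_add, map_smul,
      box_Qop, box_mx_zero, box_euler, box_pd, pd_euler]
    module
  · simp only [Ring.lie_def, Cgen, Egen_eq, Module.End.mul_apply, LinearMap.sub_apply,
      LinearMap.add_apply, LinearMap.neg_apply, LinearMap.smul_apply, Module.End.one_apply, map_add,
      map_smul, box_Qop, box_mx_succ, box_euler, box_pd, pd_euler]
    module
end
end

section
/- The eight conformal null-plane operators H_+, H_−, T_+, T_−, T_2, T_3, B_2, B_3 close into the carrier Lie algebra 𝓛 with exactly the following nonvanishing commutation relations (for a ∈ {2,3}): [H_+,T_+] = T_+, [H_+,T_a] = (1/2)T_a, [H_+,B_a] = −(1/2)B_a, [B_a,T_+] = T_a, [H_−,T_−] = T_−, [H_−,T_a] = (1/2)T_a, [H_−,B_a] = (1/2)B_a, [B_a,T_a] = T_−; all other commutators among these eight operators (in particular [H_+,H_−], [H_+,T_−], [H_−,T_+], [B_2,B_3], [B_2,T_3], [B_3,T_2], and all commutators among T_+,T_−,T_2,T_3) vanish. -/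
noncomputable section

/- Conformal null-plane basis (latin coordinate index `i ∈ {1,2,3}` is `Fin 3` index
`i-1`, so `K_1 = Kgen 0`, `J_1 = Jgen 0`, `K_2 = Kgen 1`, `J_2 = Jgen 1`, etc.). -/
def Hp (l : ℝ) : 𝔸 := (1/2 : ℝ) • (Ddil l + Kgen 0)
def Hm (l : ℝ) : 𝔸 := (1/2 : ℝ) • (Ddil l - Kgen 0)
def Tp : 𝔸 := (1/2 : ℝ) • (Pgen 0 + Pgen 1)
def Tm : 𝔸 := (1/2 : ℝ) • (Pgen 0 - Pgen 1)
def T2 : 𝔸 := (1/2 : ℝ) • (Pgen 2 - Pgen 3)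
def T3 : 𝔸 := (1/2 : ℝ) • (Pgen 2 + Pgen 3)
def B2 : 𝔸 := (1/2 : ℝ) • (Kgen 1 + Jgen 2 - Kgen 2 + Jgen 1)
def B3 : 𝔸 := (1/2 : ℝ) • (Kgen 1 + Jgen 2 + Kgen 2 - Jgen 1)
def A2 : 𝔸 := (1/2 : ℝ) • (Kgen 1 - Jgen 2 - Kgen 2 - Jgen 1)
def A3 : 𝔸 := (1/2 : ℝ) • (Kgen 1 - Jgen 2 + Kgen 2 + Jgen 1)
def Gp (l : ℝ) : 𝔸 := (1/2 : ℝ) • (C0gen l + Cgen l 0)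
def Gm (l : ℝ) : 𝔸 := (1/2 : ℝ) • (C0gen l - Cgen l 0)
def G2 (l : ℝ) : 𝔸 := (1/2 : ℝ) • (Cgen l 1 - Cgen l 2)
def G3 (l : ℝ) : 𝔸 := (1/2 : ℝ) • (Cgen l 1 + Cgen l 2)

open MvPolynomial

/-- The vector field `∑ μ, a μ ∂_μ` as a linear operator on polynomials. -/
def vectorField : (Fin 4 → MvPolynomial (Fin 4) ℝ) →ₗ[ℝ] 𝔸 where
  toFun a := (mkDerivation ℝ a).toLinearMap
  map_add' a b := by
    have h : mkDerivation ℝ (a + b) = mkDerivation ℝ a + mkDerivation ℝ b :=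
      derivation_ext fun i => by simp [mkDerivation_X]
    rw [h]; rfl
  map_smul' c a := by
    have h : mkDerivation ℝ (c • a) = c • mkDerivation ℝ a :=
      derivation_ext fun i => by simp [mkDerivation_X]
    rw [h]; rfl

theorem lie_vectorField (a b : Fin 4 → MvPolynomial (Fin 4) ℝ) :
    ⁅vectorField a, vectorField b⁆ =
      vectorField fun i => mkDerivation ℝ a (b i) - mkDerivation ℝ b (a i) := by
  have h : ⁅mkDerivation ℝ a, mkDerivation ℝ b⁆ =
      mkDerivation ℝ fun i => mkDerivation ℝ a (b i) - mkDerivation ℝ b (a i) :=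
    derivation_ext fun i => by simp [Derivation.commutator_apply, mkDerivation_X]
  change ⁅(mkDerivation ℝ a).toLinearMap, (mkDerivation ℝ b).toLinearMap⁆ =
    (mkDerivation ℝ _).toLinearMap
  rw [← h, Derivation.commutator_coe_linear_map]

theorem sub_scalar_lie (c : ℝ) (u v : 𝔸) : ⁅u - c • (1 : 𝔸), v⁆ = ⁅u, v⁆ := by
  simp [Ring.lie_def, sub_mul, mul_sub]

theorem lie_sub_scalar (c : ℝ) (u v : 𝔸) : ⁅u, v - c • (1 : 𝔸)⁆ = ⁅u, v⁆ := by
  simp [Ring.lie_def, sub_mul, mul_sub]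

theorem pd_eq_vectorField (μ : Fin 4) : pd μ = vectorField (Pi.single μ 1) := by
  have h : pderiv μ = mkDerivation ℝ (Pi.single μ (1 : MvPolynomial (Fin 4) ℝ)) :=
    derivation_ext fun i => by
      by_cases hi : i = μ
      · subst hi; simp [mkDerivation_X]
      · simp [mkDerivation_X, pderiv_X, hi]
  rw [pd, h]; rfl

theorem mx_mul_pd_eq_vectorField (μ ν : Fin 4) :
    mx μ * pd ν = vectorField (Pi.single ν (X μ)) := by
  have h : mkDerivation ℝ (Pi.single ν (X μ)) = (X μ : MvPolynomial (Fin 4) ℝ) • pderiv ν :=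
    derivation_ext fun i => by
      by_cases hi : i = ν
      · subst hi; simp [mkDerivation_X]
      · simp [mkDerivation_X, pderiv_X, hi]
  change _ = (mkDerivation ℝ _).toLinearMap
  rw [h]; rfl

theorem Tp_eq_vectorField :
    Tp = vectorField ((1/2 : ℝ) • ![1, 1, 0, 0]) := by
  simp only [Tp, Pgen, pd_eq_vectorField, ← map_add, ← map_smul]
  congr 2
  ext1 i
  fin_cases i <;> simp

theorem Tm_eq_vectorField :
    Tm = vectorField ((1/2 : ℝ) • ![1, -1, 0, 0]) := by
  simp only [Tm, Pgen, pd_eq_vectorField, ← map_sub, ← map_smul]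
  congr 2
  ext1 i
  fin_cases i <;> simp

theorem T2_eq_vectorField :
    T2 = vectorField ((1/2 : ℝ) • ![0, 0, 1, -1]) := by
  simp only [T2, Pgen, pd_eq_vectorField, ← map_sub, ← map_smul]
  congr 2
  ext1 i
  fin_cases i <;> simp

theorem T3_eq_vectorField :
    T3 = vectorField ((1/2 : ℝ) • ![0, 0, 1, 1]) := by
  simp only [T3, Pgen, pd_eq_vectorField, ← map_add, ← map_smul]
  congr 2
  ext1 i
  fin_cases i <;> simp

theorem B2_eq_vectorField :
    B2 = vectorField ((1/2 : ℝ) • ![X 3 - X 2, X 2 - X 3, -(X 0 + X 1), X 0 + X 1]) := by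
  simp only [B2, Kgen, Jgen, eps, Fin.sum_univ_three, mx_mul_pd_eq_vectorField,
    ← map_add, ← map_sub, ← map_neg, ← map_smul]
  congr 2
  ext1 i
  fin_cases i <;> norm_num [Pi.single_apply, Fin.ext_iff, show Fin.succ (2 : Fin 3) = 3 from rfl] <;>
    ring

theorem B3_eq_vectorField :
    B3 = vectorField ((1/2 : ℝ) • ![-(X 2 + X 3), X 2 + X 3, -(X 0 + X 1), -(X 0 + X 1)]) := by
  simp only [B3, Kgen, Jgen, eps, Fin.sum_univ_three, mx_mul_pd_eq_vectorField,
    ← map_add, ← map_sub, ← map_neg, ← map_smul]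
  congr 2
  ext1 i
  fin_cases i <;> norm_num [Pi.single_apply, Fin.ext_iff, show Fin.succ (2 : Fin 3) = 3 from rfl] <;>
    ring

theorem Hp_eq_vectorField (l : ℝ) :
    Hp l = vectorField ((1/2 : ℝ) • ![-(X 0 + X 1), -(X 0 + X 1), -X 2, -X 3]) -
      (l / 2) • (1 : 𝔸) := by
  have h : -(∑ μ : Fin 4, mx μ * pd μ) + Kgen 0 =
      vectorField ![-(X 0 + X 1), -(X 0 + X 1), -X 2, -X 3] := by
    simp only [Kgen, Fin.sum_univ_four, mx_mul_pd_eq_vectorField,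
      ← map_add, ← map_sub, ← map_neg]
    congr 1
    ext1 i
    fin_cases i <;> simp [Fin.ext_iff]
    ring
  rw [map_smul, ← h, Hp, Ddil]
  module

theorem Hm_eq_vectorField (l : ℝ) :
    Hm l = vectorField ((1/2 : ℝ) • ![X 1 - X 0, X 0 - X 1, -X 2, -X 3]) -
      (l / 2) • (1 : 𝔸) := by
  have h : -(∑ μ : Fin 4, mx μ * pd μ) - Kgen 0 =
      vectorField ![X 1 - X 0, X 0 - X 1, -X 2, -X 3] := by
    simp only [Kgen, Fin.sum_univ_four, mx_mul_pd_eq_vectorField,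
      ← map_add, ← map_sub, ← map_neg]
    congr 1
    ext1 i
    fin_cases i <;> simp [Fin.ext_iff] <;> ring
  rw [map_smul, ← h, Hm, Ddil]
  module

/-- The eight conformal null-plane operators close into the carrier algebra `𝓛`,
with exactly the stated nonvanishing commutators; all other brackets vanish. -/
theorem carrier_subalgebra_relations (l : ℝ) :
    ⁅Hp l, Tp⁆ = Tp ∧
    ⁅Hp l, T2⁆ = (1/2 : ℝ) • T2 ∧ ⁅Hp l, T3⁆ = (1/2 : ℝ) • T3 ∧
    ⁅Hp l, B2⁆ = -((1/2 : ℝ) • B2) ∧ ⁅Hp l, B3⁆ = -((1/2 : ℝ) • B3) ∧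
    ⁅B2, Tp⁆ = T2 ∧ ⁅B3, Tp⁆ = T3 ∧
    ⁅Hm l, Tm⁆ = Tm ∧
    ⁅Hm l, T2⁆ = (1/2 : ℝ) • T2 ∧ ⁅Hm l, T3⁆ = (1/2 : ℝ) • T3 ∧
    ⁅Hm l, B2⁆ = (1/2 : ℝ) • B2 ∧ ⁅Hm l, B3⁆ = (1/2 : ℝ) • B3 ∧
    ⁅B2, T2⁆ = Tm ∧ ⁅B3, T3⁆ = Tm ∧
    ⁅Hp l, Hm l⁆ = 0 ∧ ⁅Hp l, Tm⁆ = 0 ∧ ⁅Hm l, Tp⁆ = 0 ∧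
    ⁅B2, B3⁆ = 0 ∧ ⁅B2, T3⁆ = 0 ∧ ⁅B3, T2⁆ = 0 ∧
    ⁅B2, Tm⁆ = 0 ∧ ⁅B3, Tm⁆ = 0 ∧
    ⁅Tp, Tm⁆ = 0 ∧ ⁅Tp, T2⁆ = 0 ∧ ⁅Tp, T3⁆ = 0 ∧
    ⁅Tm, T2⁆ = 0 ∧ ⁅Tm, T3⁆ = 0 ∧ ⁅T2, T3⁆ = 0 := by
  simp only [Hp_eq_vectorField, Hm_eq_vectorField, Tp_eq_vectorField, Tm_eq_vectorField,
    T2_eq_vectorField, T3_eq_vectorField, B2_eq_vectorField, B3_eq_vectorField,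
    lie_sub_scalar, sub_scalar_lie, lie_vectorField,
    ← map_smul, ← map_neg]
  rw [← map_zero vectorField]
  refine ⟨?_, ?_, ?_, ?_, ?_, ?_, ?_, ?_, ?_, ?_, ?_, ?_, ?_, ?_, ?_, ?_, ?_, ?_, ?_, ?_, ?_, ?_,
    ?_, ?_, ?_, ?_, ?_, ?_⟩
  all_goals
    refine congrArg vectorField (funext fun i => ?_)
    fin_cases i <;> simp [mkDerivation_X] <;> module
end
end

section
/- The adjoint action of the boost K_1 defines a goodness grading with eigenvalues +1, 0, −1 on the conformal null-plane basis: [K_1, X] = X for X ∈ {T_+, A_2, A_3, G_+}; [K_1, X] = 0 for X ∈ {H_+, H_−, J_1, T_2, T_3, G_2, G_3}; and [K_1, X] = −X for X ∈ {T_−, B_2, B_3, G_−}. -/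
noncomputable section

section

attribute [local instance] LieRing.ofAssociativeRing

/-- The commutator with a fixed element is a derivation of an associative ring. -/
theorem lie_mul_eq_add {R : Type*} [Ring R] (a b c : R) :
    ⁅a, b * c⁆ = ⁅a, b⁆ * c + b * ⁅a, c⁆ := by
  simp only [Ring.lie_def]
  noncomm_ring

/-! `neg_mul`, `mul_neg` and `lie_smul` specialized to `𝔸`, where unifying the `Neg` and `SMul`
instances of linear maps with those of the ring is out of reach of `simp`. -/

theorem neg_mul_end (a b : 𝔸) : -a * b = -(a * b) :=
  neg_mul a b

theorem mul_neg_end (a b : 𝔸) : a * -b = -(a * b) :=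
  mul_neg a b

theorem lie_smul_end (r : ℝ) (a b : 𝔸) : ⁅a, r • b⁆ = r • ⁅a, b⁆ := by
  simp [Ring.lie_def, smul_sub]

theorem commute_pd (μ ν : Fin 4) : Commute (pd μ) (pd ν) := by
  have h : ⁅MvPolynomial.pderiv (R := ℝ) μ, MvPolynomial.pderiv (R := ℝ) ν⁆ = 0 := by
    refine MvPolynomial.derivation_ext fun i => ?_
    simp [Derivation.commutator_apply, MvPolynomial.pderiv_X, Pi.single_apply, apply_ite]
  refine LinearMap.ext fun p => ?_
  simpa [pd, Derivation.commutator_apply, sub_eq_zero] using congrArg (fun D => D p) h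

theorem commute_mx (μ ν : Fin 4) : Commute (mx μ) (mx ν) := by
  refine LinearMap.ext fun p => ?_
  simp only [mx, Module.End.mul_apply, LinearMap.mulLeft_apply]
  ring

theorem lie_pd_mx (μ ν : Fin 4) : ⁅pd μ, mx ν⁆ = if μ = ν then 1 else 0 := by
  refine LinearMap.ext fun p => ?_
  by_cases h : μ = ν
  · subst h
    simp [Ring.lie_def, pd, mx]
  · simp [Ring.lie_def, pd, mx, h, Ne.symm h]

theorem lie_mx_mx (μ ν : Fin 4) : ⁅mx μ, mx ν⁆ = 0 :=
  (commute_mx μ ν).lie_eq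

theorem lie_pd_pd (μ ν : Fin 4) : ⁅pd μ, pd ν⁆ = 0 :=
  (commute_pd μ ν).lie_eq

theorem lie_mul_pd_mx (μ ν ρ : Fin 4) :
    ⁅mx μ * pd ν, mx ρ⁆ = if ν = ρ then mx μ else 0 := by
  rw [← lie_skew, lie_mul_eq_add, lie_mx_mx, ← lie_skew, lie_pd_mx]
  split_ifs <;> simp [mul_neg_end]

theorem lie_mul_pd_pd (μ ν ρ : Fin 4) :
    ⁅mx μ * pd ν, pd ρ⁆ = if ρ = μ then -pd ν else 0 := by
  rw [← lie_skew, lie_mul_eq_add, lie_pd_pd, lie_pd_mx]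
  split_ifs <;> simp

theorem lie_boost_mx (ρ : Fin 4) :
    ⁅Kgen 0, mx ρ⁆ = ![-mx 1, -mx 0, 0, 0] ρ := by
  rw [Kgen, sub_lie, neg_lie, lie_mul_pd_mx, lie_mul_pd_mx]
  fin_cases ρ <;> simp

theorem lie_boost_pd (ρ : Fin 4) :
    ⁅Kgen 0, pd ρ⁆ = ![pd 1, pd 0, 0, 0] ρ := by
  rw [Kgen, sub_lie, neg_lie, lie_mul_pd_pd, lie_mul_pd_pd]
  fin_cases ρ <;> simp

theorem lie_boost_Qop : ⁅Kgen 0, Qop⁆ = 0 := by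
  simp [Qop, lie_mul_eq_add, lie_boost_mx, neg_mul_end, mul_neg_end, (commute_mx 1 0).eq]

theorem lie_boost_euler : ⁅Kgen 0, ∑ μ : Fin 4, mx μ * pd μ⁆ = 0 := by
  simp [Fin.sum_univ_four, lie_mul_eq_add, lie_boost_mx, lie_boost_pd, neg_mul_end]

theorem lie_smul_one (x : 𝔸) (l : ℝ) : ⁅x, l • (1 : 𝔸)⁆ = 0 := by
  simp [Ring.lie_def]

theorem lie_boost_Egen (l : ℝ) : ⁅Kgen 0, Egen l⁆ = 0 := by
  rw [Egen, lie_add, lie_boost_euler, lie_smul_one, add_zero]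

theorem lie_boost_Ddil (l : ℝ) : ⁅Kgen 0, Ddil l⁆ = 0 := by
  rw [Ddil, lie_sub, lie_neg, lie_boost_euler, lie_smul_one, neg_zero, sub_zero]

theorem lie_boost_C0gen (l : ℝ) : ⁅Kgen 0, C0gen l⁆ = Cgen l 0 := by
  simp [C0gen, Cgen, lie_mul_eq_add, lie_boost_Qop, lie_boost_Egen, lie_boost_mx,
    lie_boost_pd, neg_mul_end, lie_smul_end]

theorem lie_boost_Cgen (l : ℝ) (i : Fin 3) :
    ⁅Kgen 0, Cgen l i⁆ = ![C0gen l, 0, 0] i := by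
  fin_cases i <;>
    simp [C0gen, Cgen, lie_mul_eq_add, lie_boost_Qop, lie_boost_Egen, lie_boost_mx,
      lie_boost_pd, neg_mul_end, lie_smul_end, sub_eq_add_neg]

theorem Jgen_zero : Jgen 0 = mx 3 * pd 2 - mx 2 * pd 3 := by
  simp [Jgen, eps, Fin.sum_univ_three]
  module

theorem Jgen_one : Jgen 1 = mx 1 * pd 3 - mx 3 * pd 1 := by
  simp [Jgen, eps, Fin.sum_univ_three]
  module

theorem Jgen_two : Jgen 2 = mx 2 * pd 1 - mx 1 * pd 2 := by
  simp [Jgen, eps, Fin.sum_univ_three]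
  module

theorem lie_boost_Jgen (i : Fin 3) : ⁅Kgen 0, Jgen i⁆ = ![0, Kgen 2, -Kgen 1] i := by
  fin_cases i <;>
    simp [Jgen_zero, Jgen_one, Jgen_two, lie_mul_eq_add, lie_boost_mx, lie_boost_pd,
      neg_mul_end] <;>
    simp [Kgen] <;> abel

theorem lie_boost_Kgen (i : Fin 3) : ⁅Kgen 0, Kgen i⁆ = ![0, -Jgen 2, Jgen 1] i := by
  fin_cases i
  · simp
  · simp [Kgen.eq_1 1, Jgen_two, lie_mul_eq_add, lie_boost_mx, lie_boost_pd, neg_mul_end]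
    abel
  · simp [Kgen.eq_1 2, Jgen_one, lie_mul_eq_add, lie_boost_mx, lie_boost_pd, neg_mul_end]
    abel

end

/-- The adjoint action of the boost `K_1` defines the goodness grading with
eigenvalues `+1, 0, −1` on the conformal null-plane basis. -/
theorem goodness_grading (l : ℝ) :
    -- goodness +1
    ⁅Kgen 0, Tp⁆ = Tp ∧ ⁅Kgen 0, A2⁆ = A2 ∧ ⁅Kgen 0, A3⁆ = A3 ∧ ⁅Kgen 0, Gp l⁆ = Gp l ∧
    -- goodness 0
    ⁅Kgen 0, Hp l⁆ = 0 ∧ ⁅Kgen 0, Hm l⁆ = 0 ∧ ⁅Kgen 0, Jgen 0⁆ = 0 ∧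
    ⁅Kgen 0, T2⁆ = 0 ∧ ⁅Kgen 0, T3⁆ = 0 ∧ ⁅Kgen 0, G2 l⁆ = 0 ∧ ⁅Kgen 0, G3 l⁆ = 0 ∧
    -- goodness −1
    ⁅Kgen 0, Tm⁆ = -Tm ∧ ⁅Kgen 0, B2⁆ = -B2 ∧ ⁅Kgen 0, B3⁆ = -B3 ∧ ⁅Kgen 0, Gm l⁆ = -Gm l := by
  let _ := LieRing.ofAssociativeRing (A := 𝔸)
  refine ⟨?_, ?_, ?_, ?_, ?_, ?_, ?_, ?_, ?_, ?_, ?_, ?_, ?_, ?_, ?_⟩ <;>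
    simp [Tp, Tm, T2, T3, A2, A3, B2, B3, Gp, Gm, G2, G3, Hp, Hm, Pgen, lie_boost_pd,
      lie_boost_Kgen, lie_boost_Jgen, lie_boost_C0gen, lie_boost_Cgen, lie_boost_Ddil] <;>
    module
end
end

section
/- The deformed momentum and position operators satisfy the canonical (Heisenberg) commutation relations: for all μ,ν ∈ {0,1,2,3}, [p̂_μ, x̂^ν] = δ_μν · id, [p̂_μ, p̂_ν] = 0 and [x̂^μ, x̂^ν] = 0, as ℝ-linear operators on the space of smooth functions on ℝ⁴. -/
noncomputable section

/-- Real-valued functions on `ℝ⁴` (encoded as `Fin 4 → ℝ`). -/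
abbrev F : Type := (Fin 4 → ℝ) → ℝ

/-- Directional derivative `∂_μ` along the `μ`-th standard basis vector. -/
def pdf (μ : Fin 4) (φ : F) : F := fun x => fderiv ℝ φ x (Pi.single μ 1)

/-- Multiplication operator by the coordinate `x^μ`. -/
def mxf (μ : Fin 4) (φ : F) : F := fun x => x μ * φ x

/-- Translation operator `e^{a∂_μ}`: `(e^{a∂_μ}φ)(x) = φ(x + a e_μ)`. -/
def trf (a : ℝ) (μ : Fin 4) (φ : F) : F := fun x => φ (x + a • (Pi.single μ 1 : Fin 4 → ℝ))

/-- `cosh(z∂_1) = (1/2)(e^{z∂_1} + e^{−z∂_1})`. -/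
def chf (z : ℝ) (φ : F) : F := (1/2 : ℝ) • (trf z 1 φ + trf (-z) 1 φ)

/-- `sinh(z∂_1) = (1/2)(e^{z∂_1} − e^{−z∂_1})`. -/
def shf (z : ℝ) (φ : F) : F := (1/2 : ℝ) • (trf z 1 φ - trf (-z) 1 φ)

/-- Transverse Laplacian `∂_2² + ∂_3²`. -/
def lapT (φ : F) : F := pdf 2 (pdf 2 φ) + pdf 3 (pdf 3 φ)

/-- Deformed momentum `p̂_0`. -/
def phat0 (z : ℝ) (φ : F) : F :=
  (1/z) • (φ - trf (-z) 0 (chf z φ)) - (z/2) • trf (-z) 0 (trf z 1 (lapT φ))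
/-- Deformed momentum `p̂_1`. -/
def phat1 (z : ℝ) (φ : F) : F :=
  (1/z) • trf (-z) 0 (shf z φ) - (z/2) • trf (-z) 0 (trf z 1 (lapT φ))
/-- Deformed momentum `p̂_2`. -/
def phat2 (z : ℝ) (φ : F) : F := trf (-z) 0 (trf z 1 (pdf 2 φ))
/-- Deformed momentum `p̂_3`. -/
def phat3 (z : ℝ) (φ : F) : F := trf (-z) 0 (trf z 1 (pdf 3 φ))
/-- The family `p̂_μ` of deformed momenta. -/
def phat (z : ℝ) : Fin 4 → F → F := ![phat0 z, phat1 z, phat2 z, phat3 z]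

/-- Deformed position `x̂^0`. -/
def xhat0 (z : ℝ) (φ : F) : F :=
  mxf 0 (trf z 0 (chf z φ)) + mxf 1 (trf z 0 (shf z φ))
    + z • (mxf 2 (pdf 2 (trf z 0 (trf (-z) 1 φ))) + mxf 3 (pdf 3 (trf z 0 (trf (-z) 1 φ))))
    + (z^2/2) • (mxf 0 (trf z 0 (trf z 1 (lapT φ))) + mxf 1 (trf z 0 (trf z 1 (lapT φ))))
/-- Deformed position `x̂^1`. -/
def xhat1 (z : ℝ) (φ : F) : F :=
  mxf 1 (trf z 0 (chf z φ)) + mxf 0 (trf z 0 (shf z φ))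
    - z • (mxf 2 (pdf 2 (trf z 0 (trf (-z) 1 φ))) + mxf 3 (pdf 3 (trf z 0 (trf (-z) 1 φ))))
    - (z^2/2) • (mxf 0 (trf z 0 (trf z 1 (lapT φ))) + mxf 1 (trf z 0 (trf z 1 (lapT φ))))
/-- Deformed position `x̂^2`. -/
def xhat2 (z : ℝ) (φ : F) : F :=
  mxf 2 (trf z 0 (trf (-z) 1 φ))
    + z • (mxf 0 (trf z 0 (trf z 1 (pdf 2 φ))) + mxf 1 (trf z 0 (trf z 1 (pdf 2 φ))))
/-- Deformed position `x̂^3`. -/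
def xhat3 (z : ℝ) (φ : F) : F :=
  mxf 3 (trf z 0 (trf (-z) 1 φ))
    + z • (mxf 0 (trf z 0 (trf z 1 (pdf 3 φ))) + mxf 1 (trf z 0 (trf z 1 (pdf 3 φ))))
/-- The family `x̂^μ` of deformed positions. -/
def xhat (z : ℝ) : Fin 4 → F → F := ![xhat0 z, xhat1 z, xhat2 z, xhat3 z]

/-- The space of smooth functions on `ℝ⁴`. -/
def smoothFunctions : Submodule ℝ F where
  carrier := {φ | ContDiff ℝ (⊤ : ℕ∞) φ}
  add_mem' hf hg := ContDiff.add (𝕜 := ℝ) (n := (⊤ : ℕ∞)) hf hg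
  zero_mem' := contDiff_const (𝕜 := ℝ) (n := (⊤ : ℕ∞)) (c := (0 : ℝ))
  smul_mem' c _ hf := ContDiff.const_smul (𝕜 := ℝ) (n := (⊤ : ℕ∞)) c hf

namespace smoothFunctions

theorem contDiff_coe (f : smoothFunctions) : ContDiff ℝ (⊤ : ℕ∞) (f : F) := f.2

theorem differentiable_coe (f : smoothFunctions) : Differentiable ℝ (f : F) :=
  (contDiff_coe f).differentiable (by simp)

/-- The partial derivative `∂_μ` on smooth functions. -/
def partialDeriv (μ : Fin 4) : Module.End ℝ smoothFunctions where
  toFun f := ⟨pdf μ f,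
    ((contDiff_coe f).fderiv_right (m := (⊤ : ℕ∞)) le_rfl).clm_apply contDiff_const⟩
  map_add' f g := by
    ext x
    simp [pdf, fderiv_add (differentiable_coe f x) (differentiable_coe g x)]
  map_smul' c f := by
    ext x
    simp [pdf, fderiv_const_smul (differentiable_coe f x)]

/-- Multiplication by the coordinate `x^μ` on smooth functions. -/
def mulCoord (μ : Fin 4) : Module.End ℝ smoothFunctions where
  toFun f := ⟨mxf μ f, (contDiff_apply ℝ ℝ μ).mul (contDiff_coe f)⟩
  map_add' f g := by ext x; simp [mxf, mul_add]
  map_smul' c f := by ext x; simp [mxf, mul_left_comm]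

/-- The translation operator `e^{a∂_μ}` on smooth functions. -/
def shift (a : ℝ) (μ : Fin 4) : Module.End ℝ smoothFunctions where
  toFun f := ⟨trf a μ f, (contDiff_coe f).comp (contDiff_id.add contDiff_const)⟩
  map_add' _ _ := rfl
  map_smul' _ _ := rfl

theorem pdf_coe (μ : Fin 4) (f : smoothFunctions) : pdf μ f = partialDeriv μ f := rfl

theorem mxf_coe (μ : Fin 4) (f : smoothFunctions) : mxf μ f = mulCoord μ f := rfl

theorem trf_coe (a : ℝ) (μ : Fin 4) (f : smoothFunctions) : trf a μ f = shift a μ f := rfl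

theorem partialDeriv_mulCoord (μ ν : Fin 4) (f : smoothFunctions) :
    partialDeriv μ (mulCoord ν f) =
      mulCoord ν (partialDeriv μ f) + (if μ = ν then (1 : ℝ) else 0) • f := by
  ext x
  have h : HasFDerivAt (mulCoord ν f : F) _ x :=
    (hasFDerivAt_apply (𝕜 := ℝ) ν x).mul (differentiable_coe f x).hasFDerivAt
  simp only [Submodule.coe_add, Submodule.coe_smul, Pi.add_apply, Pi.smul_apply, smul_eq_mul,
    ← pdf_coe]
  rw [pdf, h.fderiv]
  simp [← mxf_coe, ← pdf_coe, mxf, pdf, Pi.single_apply, eq_comm, mul_comm]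

theorem shift_mulCoord (a : ℝ) (μ ν : Fin 4) (f : smoothFunctions) :
    shift a μ (mulCoord ν f) =
      mulCoord ν (shift a μ f) + (if μ = ν then a else 0) • shift a μ f := by
  ext x
  simp only [Submodule.coe_add, Submodule.coe_smul, Pi.add_apply, Pi.smul_apply, smul_eq_mul,
    ← trf_coe, ← mxf_coe, trf, mxf]
  simp [Pi.single_apply, add_mul, eq_comm]

theorem partialDeriv_shift (a : ℝ) (μ ν : Fin 4) (f : smoothFunctions) :
    partialDeriv μ (shift a ν f) = shift a ν (partialDeriv μ f) := by
  ext x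
  exact congrArg (· (Pi.single μ 1)) (fderiv_comp_add_right (𝕜 := ℝ) (f := (f : F)) (x := x) _)

theorem shift_shift_self (a b : ℝ) (μ : Fin 4) (f : smoothFunctions) :
    shift a μ (shift b μ f) = shift (a + b) μ f := by
  ext x
  simp [← trf_coe, trf, add_smul, add_assoc]

theorem shift_zero (μ : Fin 4) (f : smoothFunctions) : shift 0 μ f = f := by
  ext x
  simp [← trf_coe, trf]

theorem shift_comm (a b : ℝ) (μ ν : Fin 4) (f : smoothFunctions) :
    shift a μ (shift b ν f) = shift b ν (shift a μ f) := by
  ext x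
  simp [← trf_coe, trf, add_right_comm]

theorem mulCoord_comm (μ ν : Fin 4) (f : smoothFunctions) :
    mulCoord μ (mulCoord ν f) = mulCoord ν (mulCoord μ f) := by
  ext x
  simp [← mxf_coe, mxf, mul_left_comm]

theorem partialDeriv_comm (μ ν : Fin 4) (f : smoothFunctions) :
    partialDeriv μ (partialDeriv ν f) = partialDeriv ν (partialDeriv μ f) := by
  ext x
  have hd : DifferentiableAt ℝ (fderiv ℝ (f : F)) x :=
    ((contDiff_coe f).fderiv_right (m := (⊤ : ℕ∞)) le_rfl).differentiable (by simp) x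
  have hs : IsSymmSndFDerivAt ℝ (f : F) x :=
    (contDiff_coe f).contDiffAt.isSymmSndFDerivAt
      (by simpa using WithTop.coe_le_coe.2 (le_top : (2 : ℕ∞) ≤ ⊤))
  simp only [← pdf_coe]
  unfold pdf
  rw [fderiv_clm_apply hd (differentiableAt_const _),
    fderiv_clm_apply hd (differentiableAt_const _)]
  simpa using hs _ _

end smoothFunctions

set_option maxHeartbeats 2000000 in
open smoothFunctions in
/-- The deformed momentum and position operators satisfy the canonical (Heisenberg)
commutation relations on smooth functions. -/
theorem deformed_heisenberg_relations (z : ℝ) (hz : z ≠ 0) (μ ν : Fin 4) (φ : F)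
    (hφ : ContDiff ℝ (⊤ : ℕ∞) φ) :
    phat z μ (xhat z ν φ) - xhat z ν (phat z μ φ) = (if μ = ν then (1:ℝ) else 0) • φ ∧
    phat z μ (phat z ν φ) - phat z ν (phat z μ φ) = 0 ∧
    xhat z μ (xhat z ν φ) - xhat z ν (xhat z μ φ) = 0 := by
  lift φ to smoothFunctions using hφ
  have hT (a b : ℝ) (f : smoothFunctions) :
      shift a 1 (shift b 0 f) = shift b 0 (shift a 1 f) := shift_comm ..
  have hD (f : smoothFunctions) :
      partialDeriv 3 (partialDeriv 2 f) = partialDeriv 2 (partialDeriv 3 f) := partialDeriv_comm ..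
  have hX (i j : Fin 4) (_ : j < i) (f : smoothFunctions) :
      mulCoord i (mulCoord j f) = mulCoord j (mulCoord i f) := mulCoord_comm ..
  fin_cases μ <;> fin_cases ν <;>
    simp only [Fin.zero_eta, Fin.mk_one, Fin.reduceFinMk, phat, xhat, Matrix.cons_val,
      phat0, phat1, phat2, phat3, xhat0, xhat1, xhat2, xhat3, chf, shf, lapT,
      pdf_coe, mxf_coe, trf_coe, ← Submodule.coe_add, ← Submodule.coe_sub, ← Submodule.coe_smul,
      ← ZeroMemClass.coe_zero smoothFunctions, Subtype.coe_inj,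
      map_add, map_sub, map_smul, partialDeriv_mulCoord, shift_mulCoord,
      partialDeriv_shift, shift_shift_self, shift_zero, hT, hD, hX,
      Fin.reduceEq, Fin.reduceLT, if_true, if_false, zero_smul, add_zero, one_smul,
      neg_add_cancel, add_neg_cancel] <;>
    refine ⟨?_, ?_, ?_⟩ <;> match_scalars <;> (try field_simp) <;> ring
end
end

section
/- The null-plane deformed momentum and position operators satisfy the canonical (Heisenberg) commutation relations: for all μ,ν ∈ {+,−,2,3}, [p̂_μ, x̂^ν] = δ_μν · id, [p̂_μ, p̂_ν] = 0 and [x̂^μ, x̂^ν] = 0, as ℝ-linear operators on the space of smooth functions on ℝ⁴. -/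
noncomputable section

/-- Null-plane deformed momentum `p̂_+`. -/
def pnp0 (z : ℝ) (φ : F) : F := (1/z) • (φ - trf (-z) 0 φ) - z • trf (-z) 1 (lapT φ)
/-- Null-plane deformed momentum `p̂_−`. -/
def pnp1 (z : ℝ) (φ : F) : F := (1/z) • (φ - trf (-z) 1 φ)
/-- Null-plane deformed momentum `p̂_2`. -/
def pnp2 (z : ℝ) (φ : F) : F := trf (-z) 1 (pdf 2 φ)
/-- Null-plane deformed momentum `p̂_3`. -/
def pnp3 (z : ℝ) (φ : F) : F := trf (-z) 1 (pdf 3 φ)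
/-- The family `p̂_μ`, `μ ∈ {+,−,2,3}`. -/
def pnp (z : ℝ) : Fin 4 → F → F := ![pnp0 z, pnp1 z, pnp2 z, pnp3 z]

/-- Null-plane deformed position `x̂^+`. -/
def xnp0 (z : ℝ) (φ : F) : F := mxf 0 (trf z 0 φ)
/-- Null-plane deformed position `x̂^−`. -/
def xnp1 (z : ℝ) (φ : F) : F :=
  mxf 1 (trf z 1 φ) + z • (mxf 2 (pdf 2 (trf z 1 φ)) + mxf 3 (pdf 3 (trf z 1 φ)))
    + z^2 • mxf 0 (trf z 0 (lapT φ))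
/-- Null-plane deformed position `x̂^2`. -/
def xnp2 (z : ℝ) (φ : F) : F := mxf 2 (trf z 1 φ) + (2*z) • mxf 0 (trf z 0 (pdf 2 φ))
/-- Null-plane deformed position `x̂^3`. -/
def xnp3 (z : ℝ) (φ : F) : F := mxf 3 (trf z 1 φ) + (2*z) • mxf 0 (trf z 0 (pdf 3 φ))
/-- The family `x̂^μ`, `μ ∈ {+,−,2,3}`. -/
def xnp (z : ℝ) : Fin 4 → F → F := ![xnp0 z, xnp1 z, xnp2 z, xnp3 z]

open scoped ContDiff

namespace NullPlane

/-- The space of smooth real-valued functions on `ℝ⁴`. -/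
def SmoothFun : Submodule ℝ F where
  carrier := {φ | ContDiff ℝ ∞ φ}
  zero_mem' := (contDiff_const : ContDiff ℝ ∞ fun _ : Fin 4 → ℝ => (0 : ℝ))
  add_mem' {f g} (hf : ContDiff ℝ ∞ f) (hg : ContDiff ℝ ∞ g) := hf.add hg
  smul_mem' c f (hf : ContDiff ℝ ∞ f) := hf.const_smul c

theorem contDiff_coe (f : SmoothFun) : ContDiff ℝ ∞ (f : F) := f.2

theorem differentiable_coe (f : SmoothFun) : Differentiable ℝ (f : F) :=
  (contDiff_coe f).differentiable (by simp)

/-- The partial derivative `∂_μ` as an operator on smooth functions. -/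
def partialD (μ : Fin 4) : Module.End ℝ SmoothFun where
  toFun f := ⟨pdf μ f, ((contDiff_coe f).fderiv_right (m := ∞) (by simp)).clm_apply contDiff_const⟩
  map_add' f g := by
    ext x
    change fderiv ℝ ((f : F) + (g : F)) x _ = fderiv ℝ (f : F) x _ + fderiv ℝ (g : F) x _
    rw [fderiv_add (differentiable_coe f x) (differentiable_coe g x)]
    rfl
  map_smul' c f := by
    ext x
    change fderiv ℝ (c • (f : F)) x _ = c • fderiv ℝ (f : F) x _
    rw [fderiv_const_smul (differentiable_coe f x)]
    rfl

/-- Multiplication by the coordinate `x^μ` as an operator on smooth functions. -/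
def coordMul (μ : Fin 4) : Module.End ℝ SmoothFun where
  toFun f := ⟨mxf μ f, (contDiff_apply ℝ ℝ μ).mul (contDiff_coe f)⟩
  map_add' _ _ := Subtype.ext <| funext fun _ => mul_add _ _ _
  map_smul' _ _ := Subtype.ext <| funext fun _ => mul_left_comm _ _ _

/-- The translation `e^{a∂_μ}` as an operator on smooth functions. -/
def translate (a : ℝ) (μ : Fin 4) : Module.End ℝ SmoothFun where
  toFun f := ⟨trf a μ f, (contDiff_coe f).comp (contDiff_id.add contDiff_const)⟩
  map_add' _ _ := rfl
  map_smul' _ _ := rfl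

theorem partialD_comm (μ ν : Fin 4) (f : SmoothFun) :
    partialD μ (partialD ν f) = partialD ν (partialD μ f) := by
  ext x
  have hd : DifferentiableAt ℝ (fderiv ℝ (f : F)) x :=
    ((contDiff_coe f).fderiv_right (m := ∞) (by simp)).differentiable (by simp) x
  have key (α β : Fin 4) : (partialD α (partialD β f) : F) x =
      fderiv ℝ (fderiv ℝ (f : F)) x (Pi.single α 1) (Pi.single β 1) := by
    change fderiv ℝ (fun y => fderiv ℝ (f : F) y (Pi.single β 1)) x (Pi.single α 1) = _
    rw [fderiv_clm_apply hd (differentiableAt_const _)]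
    simp
  rw [key, key]
  exact ((contDiff_coe f).contDiffAt.isSymmSndFDerivAt
    (by simpa using WithTop.coe_le_coe.2 (le_top : (2 : ℕ∞) ≤ ⊤))) _ _

theorem partialD_coordMul (μ ν : Fin 4) (f : SmoothFun) :
    partialD μ (coordMul ν f) =
      coordMul ν (partialD μ f) + (if μ = ν then (1 : ℝ) else 0) • f := by
  ext x
  change fderiv ℝ (fun y => y ν * (f : F) y) x (Pi.single μ 1) =
    x ν * fderiv ℝ (f : F) x (Pi.single μ 1) + (if μ = ν then (1 : ℝ) else 0) * (f : F) x
  rw [fderiv_fun_mul (differentiableAt_apply ν x) (differentiable_coe f x),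
    fderiv_apply differentiableAt_id]
  simp [Pi.single_apply, eq_comm, mul_comm]

theorem partialD_translate (μ ν : Fin 4) (a : ℝ) (f : SmoothFun) :
    partialD μ (translate a ν f) = translate a ν (partialD μ f) := by
  ext x
  change fderiv ℝ (fun y => (f : F) (y + a • (Pi.single ν 1 : Fin 4 → ℝ))) x _ =
    fderiv ℝ (f : F) (x + a • (Pi.single ν 1 : Fin 4 → ℝ)) _
  rw [fderiv_comp_add_right]

theorem coordMul_comm (μ ν : Fin 4) (f : SmoothFun) :
    coordMul μ (coordMul ν f) = coordMul ν (coordMul μ f) :=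
  Subtype.ext <| funext fun _ => mul_left_comm _ _ _

theorem translate_coordMul (a : ℝ) (μ ν : Fin 4) (f : SmoothFun) :
    translate a μ (coordMul ν f) =
      coordMul ν (translate a μ f) + (if μ = ν then a else 0) • translate a μ f := by
  ext x
  change (x + a • (Pi.single μ 1 : Fin 4 → ℝ)) ν * trf a μ f x =
    x ν * trf a μ f x + (if μ = ν then a else 0) * trf a μ f x
  rw [← add_mul]
  congr 1
  simp [Pi.single_apply, eq_comm]

theorem translate_comm (a b : ℝ) (μ ν : Fin 4) (f : SmoothFun) :
    translate a μ (translate b ν f) = translate b ν (translate a μ f) :=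
  Subtype.ext <| funext fun _ => congrArg (f : F) (add_right_comm _ _ _)

theorem translate_translate (a b : ℝ) (μ : Fin 4) (f : SmoothFun) :
    translate a μ (translate b μ f) = translate (a + b) μ f :=
  Subtype.ext <| funext fun _ => congrArg (f : F) (by rw [add_smul, add_assoc])

theorem translate_zero (μ : Fin 4) (f : SmoothFun) : translate 0 μ f = f :=
  Subtype.ext <| funext fun _ => congrArg (f : F) (by rw [zero_smul, add_zero])

/-- The deformed momenta `p̂_μ` on smooth functions. -/
def momentum (z : ℝ) : Fin 4 → SmoothFun → SmoothFun :=
  ![fun f => (1 / z) • (f - translate (-z) 0 f)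
      - z • translate (-z) 1 (partialD 2 (partialD 2 f) + partialD 3 (partialD 3 f)),
    fun f => (1 / z) • (f - translate (-z) 1 f),
    fun f => translate (-z) 1 (partialD 2 f),
    fun f => translate (-z) 1 (partialD 3 f)]

/-- The deformed positions `x̂^μ` on smooth functions. -/
def position (z : ℝ) : Fin 4 → SmoothFun → SmoothFun :=
  ![fun f => coordMul 0 (translate z 0 f),
    fun f => coordMul 1 (translate z 1 f)
      + z • (coordMul 2 (partialD 2 (translate z 1 f)) + coordMul 3 (partialD 3 (translate z 1 f)))
      + z ^ 2 • coordMul 0 (translate z 0 (partialD 2 (partialD 2 f) + partialD 3 (partialD 3 f))),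
    fun f => coordMul 2 (translate z 1 f) + (2 * z) • coordMul 0 (translate z 0 (partialD 2 f)),
    fun f => coordMul 3 (translate z 1 f) + (2 * z) • coordMul 0 (translate z 0 (partialD 3 f))]

theorem coe_momentum (z : ℝ) (μ : Fin 4) (f : SmoothFun) :
    (momentum z μ f : F) = pnp z μ f := by
  fin_cases μ <;> rfl

theorem coe_position (z : ℝ) (μ : Fin 4) (f : SmoothFun) :
    (position z μ f : F) = xnp z μ f := by
  fin_cases μ <;> rfl

set_option maxHeartbeats 4000000 in
theorem momentum_position_sub (z : ℝ) (hz : z ≠ 0) (μ ν : Fin 4) (f : SmoothFun) :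
    momentum z μ (position z ν f) - position z ν (momentum z μ f) =
      (if μ = ν then (1 : ℝ) else 0) • f := by
  fin_cases μ <;> fin_cases ν <;>
    simp [momentum, position, partialD_coordMul, partialD_translate, translate_coordMul,
      translate_comm _ _ 1 0, translate_translate, translate_zero, partialD_comm 3 2] <;>
    match_scalars <;> field_simp <;> ring

set_option maxHeartbeats 4000000 in
theorem momentum_comm (z : ℝ) (μ ν : Fin 4) (f : SmoothFun) :
    momentum z μ (momentum z ν f) = momentum z ν (momentum z μ f) := by
  fin_cases μ <;> fin_cases ν <;>
    simp [momentum, partialD_translate, translate_comm _ _ 1 0, partialD_comm 3 2] <;>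
    module

set_option maxHeartbeats 4000000 in
theorem position_comm (z : ℝ) (μ ν : Fin 4) (f : SmoothFun) :
    position z μ (position z ν f) = position z ν (position z μ f) := by
  fin_cases μ <;> fin_cases ν <;>
    simp [position, partialD_coordMul, partialD_translate, translate_coordMul,
      translate_comm _ _ 1 0, translate_translate, partialD_comm 3 2, coordMul_comm 1 0,
      coordMul_comm 2 0, coordMul_comm 3 0, coordMul_comm 2 1, coordMul_comm 3 1,
      coordMul_comm 3 2] <;>
    module

end NullPlane

open NullPlane in
/-- The null-plane deformed momentum and position operators satisfy the canonical
(Heisenberg) commutation relations on smooth functions. -/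
theorem null_plane_heisenberg_relations (z : ℝ) (hz : z ≠ 0) (μ ν : Fin 4) (φ : F)
    (hφ : ContDiff ℝ (⊤ : ℕ∞) φ) :
    pnp z μ (xnp z ν φ) - xnp z ν (pnp z μ φ) = (if μ = ν then (1:ℝ) else 0) • φ ∧
    pnp z μ (pnp z ν φ) - pnp z ν (pnp z μ φ) = 0 ∧
    xnp z μ (xnp z ν φ) - xnp z ν (xnp z μ φ) = 0 := by
  lift φ to SmoothFun using hφ
  simp only [← coe_momentum, ← coe_position]
  refine ⟨?_, ?_, ?_⟩
  · exact congrArg Subtype.val (momentum_position_sub z hz μ ν φ)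
  · rw [momentum_comm, sub_self]
  · rw [position_comm, sub_self]
end
end

section
/- The deformed quadratic Casimir equals the difference-differential d'Alembertian: as operators on smooth functions on ℝ⁴, p̂_0∘p̂_0 − p̂_1∘p̂_1 − p̂_2∘p̂_2 − p̂_3∘p̂_3 = (1/z²)(1 − e^{−z∂_0}e^{−z∂_1})∘(1 − e^{−z∂_0}e^{z∂_1}) − e^{−z∂_0}e^{z∂_1}∘(∂_2² + ∂_3²) =: □_z; consequently the deformed massless Klein–Gordon equation □_z φ = 0 is the equation annihilated by the twisted translation generators' Casimir. -/
noncomputable section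

/-- The difference-differential d'Alembertian
`□_z = (1/z²)(1 − e^{−z∂_0}e^{−z∂_1})(1 − e^{−z∂_0}e^{z∂_1}) − e^{−z∂_0}e^{z∂_1}(∂_2²+∂_3²)`. -/
def boxz (z : ℝ) (φ : F) : F :=
  (1/z^2) • ((fun ψ => ψ - trf (-z) 0 (trf (-z) 1 ψ)) ((fun ψ => ψ - trf (-z) 0 (trf z 1 ψ)) φ))
    - trf (-z) 0 (trf z 1 (lapT φ))

theorem ContDiff.pdf {φ : F} (hφ : ContDiff ℝ (⊤ : ℕ∞) φ) (μ : Fin 4) :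
    ContDiff ℝ (⊤ : ℕ∞) (pdf μ φ) :=
  (hφ.fderiv_right (m := (⊤ : ℕ∞)) (by exact_mod_cast le_top)).clm_apply contDiff_const

theorem ContDiff.trf {φ : F} (hφ : ContDiff ℝ (⊤ : ℕ∞) φ) (a : ℝ) (μ : Fin 4) :
    ContDiff ℝ (⊤ : ℕ∞) (trf a μ φ) :=
  hφ.comp (contDiff_id.add contDiff_const)

theorem ContDiff.lapT {φ : F} (hφ : ContDiff ℝ (⊤ : ℕ∞) φ) :
    ContDiff ℝ (⊤ : ℕ∞) (lapT φ) :=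
  ((hφ.pdf 2).pdf 2).add ((hφ.pdf 3).pdf 3)

theorem pdf_trf (a : ℝ) (μ ν : Fin 4) (φ : F) : pdf μ (trf a ν φ) = trf a ν (pdf μ φ) := by
  funext x
  exact congrArg (fun L => L (Pi.single μ 1))
    (fderiv_comp_add_right (𝕜 := ℝ) (f := φ) (x := x) (a • (Pi.single ν 1 : Fin 4 → ℝ)))

theorem pdf_smul (c : ℝ) (μ : Fin 4) (φ : F) : pdf μ (c • φ) = c • pdf μ φ := by
  funext x
  simp [pdf, fderiv_const_smul_field]

theorem pdf_add (μ : Fin 4) {φ ψ : F} (hφ : ContDiff ℝ (⊤ : ℕ∞) φ)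
    (hψ : ContDiff ℝ (⊤ : ℕ∞) ψ) : pdf μ (φ + ψ) = pdf μ φ + pdf μ ψ := by
  funext x
  simp [pdf, fderiv_add (hφ.differentiable (by simp) x) (hψ.differentiable (by simp) x)]

theorem pdf_sub (μ : Fin 4) {φ ψ : F} (hφ : ContDiff ℝ (⊤ : ℕ∞) φ)
    (hψ : ContDiff ℝ (⊤ : ℕ∞) ψ) : pdf μ (φ - ψ) = pdf μ φ - pdf μ ψ := by
  funext x
  simp [pdf, fderiv_sub (hφ.differentiable (by simp) x) (hψ.differentiable (by simp) x)]

theorem lapT_trf (a : ℝ) (ν : Fin 4) (φ : F) : lapT (trf a ν φ) = trf a ν (lapT φ) := by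
  simp only [lapT, pdf_trf]
  rfl

theorem lapT_smul (c : ℝ) (φ : F) : lapT (c • φ) = c • lapT φ := by
  simp only [lapT, pdf_smul, smul_add]

theorem lapT_add {φ ψ : F} (hφ : ContDiff ℝ (⊤ : ℕ∞) φ) (hψ : ContDiff ℝ (⊤ : ℕ∞) ψ) :
    lapT (φ + ψ) = lapT φ + lapT ψ := by
  simp only [lapT, pdf_add _ hφ hψ, pdf_add _ (hφ.pdf _) (hψ.pdf _)]
  abel

theorem lapT_sub {φ ψ : F} (hφ : ContDiff ℝ (⊤ : ℕ∞) φ) (hψ : ContDiff ℝ (⊤ : ℕ∞) ψ) :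
    lapT (φ - ψ) = lapT φ - lapT ψ := by
  simp only [lapT, pdf_sub _ hφ hψ, pdf_sub _ (hφ.pdf _) (hψ.pdf _)]
  abel

theorem trf_add (a : ℝ) (μ : Fin 4) (φ ψ : F) : trf a μ (φ + ψ) = trf a μ φ + trf a μ ψ := rfl

theorem trf_sub (a : ℝ) (μ : Fin 4) (φ ψ : F) : trf a μ (φ - ψ) = trf a μ φ - trf a μ ψ := rfl

theorem trf_smul (a : ℝ) (μ : Fin 4) (c : ℝ) (φ : F) : trf a μ (c • φ) = c • trf a μ φ := rfl

theorem trf_comm (a b : ℝ) (μ ν : Fin 4) (φ : F) :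
    trf a μ (trf b ν φ) = trf b ν (trf a μ φ) := by
  funext x
  simp only [trf, add_right_comm]

theorem trf_neg_trf (a : ℝ) (μ : Fin 4) (φ : F) : trf (-a) μ (trf a μ φ) = φ := by
  funext x
  simp [trf]

theorem lapT_chf {φ : F} (hφ : ContDiff ℝ (⊤ : ℕ∞) φ) (z : ℝ) :
    lapT (chf z φ) = chf z (lapT φ) := by
  simp only [chf, lapT_smul, lapT_add (hφ.trf _ _) (hφ.trf _ _), lapT_trf]

theorem lapT_shf {φ : F} (hφ : ContDiff ℝ (⊤ : ℕ∞) φ) (z : ℝ) :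
    lapT (shf z φ) = shf z (lapT φ) := by
  simp only [shf, lapT_smul, lapT_sub (hφ.trf _ _) (hφ.trf _ _), lapT_trf]

theorem ContDiff.chf {φ : F} (hφ : ContDiff ℝ (⊤ : ℕ∞) φ) (z : ℝ) :
    ContDiff ℝ (⊤ : ℕ∞) (chf z φ) :=
  contDiff_const.mul ((hφ.trf z 1).add (hφ.trf (-z) 1))

theorem ContDiff.shf {φ : F} (hφ : ContDiff ℝ (⊤ : ℕ∞) φ) (z : ℝ) :
    ContDiff ℝ (⊤ : ℕ∞) (shf z φ) :=
  contDiff_const.mul ((hφ.trf z 1).sub (hφ.trf (-z) 1))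

theorem lapT_phat0 {φ : F} (hφ : ContDiff ℝ (⊤ : ℕ∞) φ) (z : ℝ) :
    lapT (phat0 z φ) = phat0 z (lapT φ) := by
  have hc := (hφ.chf z).trf (-z) 0
  have hd : ContDiff ℝ (⊤ : ℕ∞) ((1/z) • (φ - trf (-z) 0 (chf z φ))) :=
    contDiff_const.mul (hφ.sub hc)
  have hl : ContDiff ℝ (⊤ : ℕ∞) ((z/2) • trf (-z) 0 (trf z 1 (lapT φ))) :=
    contDiff_const.mul ((hφ.lapT.trf z 1).trf (-z) 0)
  rw [phat0, lapT_sub hd hl, lapT_smul, lapT_smul, lapT_sub hφ hc, lapT_trf, lapT_trf, lapT_trf,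
    lapT_chf hφ, phat0]

theorem lapT_phat1 {φ : F} (hφ : ContDiff ℝ (⊤ : ℕ∞) φ) (z : ℝ) :
    lapT (phat1 z φ) = phat1 z (lapT φ) := by
  have hs : ContDiff ℝ (⊤ : ℕ∞) ((1/z) • trf (-z) 0 (shf z φ)) :=
    contDiff_const.mul ((hφ.shf z).trf (-z) 0)
  have hl : ContDiff ℝ (⊤ : ℕ∞) ((z/2) • trf (-z) 0 (trf z 1 (lapT φ))) :=
    contDiff_const.mul ((hφ.lapT.trf z 1).trf (-z) 0)
  rw [phat1, lapT_sub hs hl, lapT_smul, lapT_smul, lapT_trf, lapT_trf, lapT_trf,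
    lapT_shf hφ, phat1]

/-- The deformed quadratic Casimir `p̂_0² − p̂_1² − p̂_2² − p̂_3²` equals the
difference-differential d'Alembertian `□_z` on smooth functions. -/
theorem deformed_casimir_eq_boxz (z : ℝ) (hz : z ≠ 0) (φ : F) (hφ : ContDiff ℝ (⊤ : ℕ∞) φ) :
    phat0 z (phat0 z φ) - phat1 z (phat1 z φ) - phat2 z (phat2 z φ) - phat3 z (phat3 z φ)
      = boxz z φ := by
  have hp0 : phat0 z (phat0 z φ) = (1/z) • (phat0 z φ - trf (-z) 0 (chf z (phat0 z φ)))
      - (z/2) • trf (-z) 0 (trf z 1 (phat0 z (lapT φ))) := by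
    rw [← lapT_phat0 hφ, phat0]
  have hp1 : phat1 z (phat1 z φ) = (1/z) • trf (-z) 0 (shf z (phat1 z φ))
      - (z/2) • trf (-z) 0 (trf z 1 (phat1 z (lapT φ))) := by
    rw [← lapT_phat1 hφ, phat1]
  have hp23 : phat2 z (phat2 z φ) + phat3 z (phat3 z φ)
      = trf (-z) 0 (trf (-z) 0 (trf z 1 (trf z 1 (lapT φ)))) := by
    simp only [phat2, phat3, pdf_trf, trf_comm z (-z) 1 0, lapT, trf_add]
  rw [sub_sub _ (phat2 z (phat2 z φ)), hp23, hp0, hp1]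
  simp only [phat0, phat1, chf, shf, boxz, trf_add, trf_sub, trf_smul,
    trf_comm z (-z) 1 0, trf_comm (-z) (-z) 1 0, trf_comm z (-z) 1 1, trf_neg_trf]
  funext x
  simp only [Pi.add_apply, Pi.sub_apply, Pi.smul_apply, smul_eq_mul]
  field_simp
  ring
end
end
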